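/- arXiv:1712.00864 — 2 statements merged into one kernel-verified Lean document; each statement's English description precedes it below -/
import Mathlib

section
/- For every infinite bit sequence A, if Δ(A) > 0 then Δ(A) = 1/2. -/
open Filter

namespace Paper

/-! ### Oracle computability -/

/-- Codes for oracle Turing functionals (partial recursive operators with one
function oracle), following the pattern of `Nat.Partrec.Code`. -/
inductive OracleCode : Type
  | zero
  | succ
  | left
  | right
  | oracle
  | pair : OracleCode → OracleCode → OracleCode
  | comp : OracleCode → OracleCode → OracleCode
  | prec : OracleCode → OracleCode → OracleCode
  | rfind' : OracleCode → OracleCode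

/-- Evaluation of an oracle code with oracle `g : ℕ → ℕ`. -/
def OracleCode.eval (g : ℕ → ℕ) : OracleCode → ℕ →. ℕ
  | .zero => pure 0
  | .succ => Nat.succ
  | .left => ↑fun n : ℕ => n.unpair.1
  | .right => ↑fun n : ℕ => n.unpair.2
  | .oracle => ↑fun n : ℕ => g n
  | .pair cf cg => fun n => Nat.pair <$> eval g cf n <*> eval g cg n
  | .comp cf cg => fun n => eval g cg n >>= eval g cf
  | .prec cf cg =>
    Nat.unpaired fun a n =>
      n.rec (eval g cf a) fun y IH => do
        let i ← IH
        eval g cg (Nat.pair a (Nat.pair y i))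
  | .rfind' cf =>
    Nat.unpaired fun a m =>
      (Nat.rfind fun n => (fun m => m = 0) <$> eval g cf (Nat.pair a (n + m))).map (· + m)

/-- Turing reducibility: `f ≤_T g` iff some oracle functional with oracle `g`
computes `f` (totally). -/
def TuringLE (f g : ℕ → ℕ) : Prop :=
  ∃ c : OracleCode, ∀ n, OracleCode.eval g c n = Part.some (f n)

/-- Turing equivalence. -/
def TuringEquiv (f g : ℕ → ℕ) : Prop := TuringLE f g ∧ TuringLE g f

/-- A mass problem is a set of functions `ℕ → ℕ`. -/
abbrev MassProblem := Set (ℕ → ℕ)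

/-- Muchnik (weak) reducibility `B ≤_W C`. -/
def MuchnikLE (B C : MassProblem) : Prop := ∀ g ∈ C, ∃ f ∈ B, TuringLE f g

/-- Muchnik equivalence. -/
def MuchnikEquiv (B C : MassProblem) : Prop := MuchnikLE B C ∧ MuchnikLE C B

/-- Medvedev (strong) reducibility `B ≤_S C`: a single Turing functional is
defined on all of `C` and maps each member of `C` to a member of `B`. -/
def MedvedevLE (B C : MassProblem) : Prop :=
  ∃ c : OracleCode, ∀ g ∈ C, ∃ f ∈ B, ∀ n, OracleCode.eval g c n = Part.some (f n)

/-- Medvedev equivalence. -/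
def MedvedevEquiv (B C : MassProblem) : Prop := MedvedevLE B C ∧ MedvedevLE C B

/-! ### Density notions -/

/-- Lower (asymptotic) density of a set of naturals. -/
noncomputable def lowerDensity (z : Set ℕ) : ℝ :=
  Filter.liminf (fun n => (Nat.card ↥(z ∩ Set.Iio n) : ℝ) / n) Filter.atTop

/-- `x ↔ y`: the agreement set of two functions. -/
def agree (x y : ℕ → ℕ) : Set ℕ := {n | x n = y n}

/-- A bit sequence is a `{0,1}`-valued function. -/
def IsBitSeq (x : ℕ → ℕ) : Prop := ∀ n, x n < 2

/-- The mass problem `D(p)`. -/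
def probD (p : ℝ) : MassProblem :=
  {y | IsBitSeq y ∧ ∀ x : ℕ → ℕ, IsBitSeq x → Computable x →
    lowerDensity (agree x y) ≤ p}

/-- The mass problem `B(p)`. -/
def probB (p : ℝ) : MassProblem :=
  {y | IsBitSeq y ∧ ∀ x : ℕ → ℕ, IsBitSeq x → Computable x →
    p < lowerDensity (agree x y)}

/-- The mass problem `IOE(h)`. -/
def IOE (h : ℕ → ℕ) : MassProblem :=
  {f | ∀ x : ℕ → ℕ, Computable x → (∀ n, x n < h n) → ∃ᶠ n in atTop, f n = x n}

/-- The mass problem `AED(h)`. -/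
def AED (h : ℕ → ℕ) : MassProblem :=
  {f | (∀ n, f n < h n) ∧ ∀ x : ℕ → ℕ, Computable x → ∀ᶠ n in atTop, f n ≠ x n}

/-! ### Hamming distance and the problems `D⟨≠*,ĥ,q⟩`, `B⟨≠*,ĥ,q⟩` -/

/-- Normalized Hamming distance between `a` and `b`, viewed as binary strings
of length `r` (via binary expansion with leading zeros). -/
noncomputable def nhd (r a b : ℕ) : ℝ :=
  (((Finset.range r).filter fun i => a.testBit i ≠ b.testBit i).card : ℝ) / r

/-- The mass problem `D⟨≠*, ĥ, q⟩`. -/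
def probDneq (hh : ℕ → ℕ) (q : ℝ) : MassProblem :=
  {y | (∀ n, y n < 2 ^ hh n) ∧ ∀ x : ℕ → ℕ, Computable x → (∀ n, x n < 2 ^ hh n) →
    ∃ᶠ n in atTop, nhd (hh n) (x n) (y n) < q}

/-- The mass problem `B⟨≠*, ĥ, q⟩`. -/
def probBneq (hh : ℕ → ℕ) (q : ℝ) : MassProblem :=
  {y | (∀ n, y n < 2 ^ hh n) ∧ ∀ x : ℕ → ℕ, Computable x → (∀ n, x n < 2 ^ hh n) →
    ∀ᶠ n in atTop, q ≤ nhd (hh n) (x n) (y n)}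

/-! ### Slaloms, coded as functions `ℕ → ℕ` via binary digits -/

/-- `s : ℕ → ℕ`, coding finite sets via binary digits (`i ∈ s(n)` iff the
`i`-th bit of `s n` is set), is an `L`-slalom bounded by `u`. -/
def IsSlalomCode (u : ℕ → ℕ) (L : ℕ) (s : ℕ → ℕ) : Prop :=
  ∀ n, (∀ i, (s n).testBit i = true → i < u n) ∧
    ((Finset.range (u n)).filter fun i => (s n).testBit i = true).card ≤ L

/-- The mass problem `D⟨∌*, u, L⟩`. -/
def probDSlalom (u : ℕ → ℕ) (L : ℕ) : MassProblem :=
  {s | IsSlalomCode u L s ∧ ∀ y : ℕ → ℕ, Computable y → (∀ n, y n < u n) →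
    ∃ᶠ n in atTop, (s n).testBit (y n) = true}

/-- The mass problem `B⟨∌*, u, L⟩`. -/
def probBSlalom (u : ℕ → ℕ) (L : ℕ) : MassProblem :=
  {y | (∀ n, y n < u n) ∧ ∀ s : ℕ → ℕ, Computable s → IsSlalomCode u L s →
    ∀ᶠ n in atTop, (s n).testBit (y n) = false}

/-! ### Gamma and Delta values -/

/-- `γ(A)`. -/
noncomputable def gammaVal (A : ℕ → ℕ) : ℝ :=
  sSup ((fun x => lowerDensity (agree A x)) '' {x | IsBitSeq x ∧ Computable x})

/-- `Γ(A)`. -/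
noncomputable def GammaVal (A : ℕ → ℕ) : ℝ :=
  sInf (gammaVal '' {Y | IsBitSeq Y ∧ TuringEquiv Y A})

/-- `δ(A)`. -/
noncomputable def deltaVal (A : ℕ → ℕ) : ℝ :=
  sInf ((fun x => lowerDensity (agree A x)) '' {x | IsBitSeq x ∧ Computable x})

/-- `Δ(A)`. -/
noncomputable def DeltaVal (A : ℕ → ℕ) : ℝ :=
  sSup (deltaVal '' {Y | IsBitSeq Y ∧ TuringLE Y A})

/-! ### Cardinal characteristics -/

/-- The cardinal characteristic `𝔡(p)`. -/
noncomputable def dChar (p : ℝ) : Cardinal :=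
  sInf {c : Cardinal | ∃ G : Set (ℕ → ℕ), c = Cardinal.mk G ∧ (∀ y ∈ G, IsBitSeq y) ∧
    ∀ x : ℕ → ℕ, IsBitSeq x → ∃ y ∈ G, p < lowerDensity (agree x y)}

/-- The cardinal characteristic `𝔟(p)`. -/
noncomputable def bChar (p : ℝ) : Cardinal :=
  sInf {c : Cardinal | ∃ F : Set (ℕ → ℕ), c = Cardinal.mk F ∧ (∀ x ∈ F, IsBitSeq x) ∧
    ∀ y : ℕ → ℕ, IsBitSeq y → ∃ x ∈ F, lowerDensity (agree x y) ≤ p}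

/-- The cardinal characteristic `𝔡(≠*, h)`. -/
noncomputable def dNeq (h : ℕ → ℕ) : Cardinal :=
  sInf {c : Cardinal | ∃ G : Set (ℕ → ℕ), c = Cardinal.mk G ∧ (∀ y ∈ G, ∀ n, y n < h n) ∧
    ∀ x : ℕ → ℕ, ∃ y ∈ G, ∀ᶠ n in atTop, x n ≠ y n}

/-- The cardinal characteristic `𝔟(≠*, h)`. -/
noncomputable def bNeq (h : ℕ → ℕ) : Cardinal :=
  sInf {c : Cardinal | ∃ F : Set (ℕ → ℕ), c = Cardinal.mk F ∧
    ∀ y : ℕ → ℕ, (∀ n, y n < h n) → ∃ x ∈ F, ∃ᶠ n in atTop, x n = y n}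

/-- The cardinal characteristic `𝔡⟨≠*, ĥ, q⟩`. -/
noncomputable def dHam (hh : ℕ → ℕ) (q : ℝ) : Cardinal :=
  sInf {c : Cardinal | ∃ G : Set (ℕ → ℕ), c = Cardinal.mk G ∧
    (∀ y ∈ G, ∀ n, y n < 2 ^ hh n) ∧
    ∀ x : ℕ → ℕ, (∀ n, x n < 2 ^ hh n) →
      ∃ y ∈ G, ∀ᶠ n in atTop, q ≤ nhd (hh n) (x n) (y n)}

/-- The cardinal characteristic `𝔟⟨≠*, ĥ, q⟩`. -/
noncomputable def bHam (hh : ℕ → ℕ) (q : ℝ) : Cardinal :=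
  sInf {c : Cardinal | ∃ F : Set (ℕ → ℕ), c = Cardinal.mk F ∧
    (∀ x ∈ F, ∀ n, x n < 2 ^ hh n) ∧
    ∀ y : ℕ → ℕ, (∀ n, y n < 2 ^ hh n) →
      ∃ x ∈ F, ∃ᶠ n in atTop, nhd (hh n) (x n) (y n) < q}

/-- `s : ℕ → Finset ℕ` is an `L`-slalom bounded by `u`. -/
def IsSlalom (u : ℕ → ℕ) (L : ℕ) (s : ℕ → Finset ℕ) : Prop :=
  ∀ n, (∀ i ∈ s n, i < u n) ∧ (s n).card ≤ L

/-- The cardinal characteristic `𝔡⟨∌*, u, L⟩`. -/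
noncomputable def dSlalom (u : ℕ → ℕ) (L : ℕ) : Cardinal :=
  sInf {c : Cardinal | ∃ G : Set (ℕ → ℕ), c = Cardinal.mk G ∧ (∀ y ∈ G, ∀ n, y n < u n) ∧
    ∀ s : ℕ → Finset ℕ, IsSlalom u L s → ∃ y ∈ G, ∀ᶠ n in atTop, y n ∉ s n}

/-- The cardinal characteristic `𝔟⟨∌*, u, L⟩`. -/
noncomputable def bSlalom (u : ℕ → ℕ) (L : ℕ) : Cardinal :=
  sInf {c : Cardinal | ∃ F : Set (ℕ → Finset ℕ), c = Cardinal.mk F ∧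
    (∀ s ∈ F, IsSlalom u L s) ∧
    ∀ y : ℕ → ℕ, (∀ n, y n < u n) → ∃ s ∈ F, ∃ᶠ n in atTop, y n ∈ s n}

/-! ### Order functions and list decoding -/

/-- An order function: nondecreasing, unbounded and computable. -/
def IsOrderFunc (F : ℕ → ℕ) : Prop :=
  Computable F ∧ Monotone F ∧ ∀ b : ℕ, ∃ n, b < F n

/-- The list-decoding property for parameters `q`, `ε`, `L`: for every length `r`
there is a set `C` of `2^⌊εr⌋` binary strings of length `r` (coded as numbers
below `2^r`) such that every string has at most `L` elements of `C` within
normalized Hamming distance `< q`. -/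
def ListDecoding (q ε : ℝ) (L : ℕ) : Prop :=
  ∀ r : ℕ, ∃ C : Finset ℕ, (∀ a ∈ C, a < 2 ^ r) ∧ C.card = 2 ^ ⌊ε * r⌋₊ ∧
    ∀ σ < 2 ^ r, (C.filter fun τ => nhd r σ τ < q).card ≤ L



/-! ### Computability of the ingredients -/

section Comp

variable {α : Type*} [Primcodable α]

theorem primrec_pow {f h : α → ℕ} (hf : Primrec f) (hh : Primrec h) :
    Primrec fun x => f x ^ h x :=
  (Primrec.nat_rec' (h := fun x (p : ℕ × ℕ) => p.2 * f x) hh (Primrec.const 1)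
    (Primrec.nat_mul.comp (Primrec.snd.comp Primrec.snd) (hf.comp Primrec.fst)).to₂).of_eq
    fun x => by
      induction h x with
      | zero => simp
      | succ n ih => simp only [pow_succ]; rw [← ih]

theorem primrec_sum {f : α → ℕ → ℕ} {h : α → ℕ} (hf : Primrec₂ f) (hh : Primrec h) :
    Primrec fun x => ∑ i ∈ Finset.range (h x), f x i :=
  (Primrec.nat_rec' (h := fun x (p : ℕ × ℕ) => p.2 + f x p.1) hh (Primrec.const 0)
    (Primrec.nat_add.comp (Primrec.snd.comp Primrec.snd)
      (hf.comp Primrec.fst (Primrec.fst.comp Primrec.snd))).to₂).of_eq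
    fun x => by
      induction h x with
      | zero => simp
      | succ n ih => rw [Finset.sum_range_succ, ← ih]

theorem computable_sum {f : ℕ → ℕ} (hf : Computable f) :
    Computable fun n => ∑ i ∈ Finset.range n, f i :=
  (Computable.nat_rec (h := fun (_ : ℕ) (p : ℕ × ℕ) => p.2 + f p.1) Computable.id
    (Computable.const 0)
    (Primrec.nat_add.to_comp.comp (Computable.snd.comp Computable.snd)
      (hf.comp (Computable.fst.comp Computable.snd))).to₂).of_eq
    fun n => by
      simp only [id]
      induction n with
      | zero => simp
      | succ n ih => rw [Finset.sum_range_succ, ← ih]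

theorem primrec_prime : PrimrecPred Nat.Prime := by
  have h1 : PrimrecRel fun (m p : ℕ) => ¬ (p % m = 0) ∨ m = 1 :=
    PrimrecPred.or ((Primrec.eq.comp (Primrec.nat_mod.comp Primrec.snd Primrec.fst)
      (Primrec.const 0)).not) (Primrec.eq.comp Primrec.fst (Primrec.const 1))
  have h2 := (PrimrecRel.forall_lt h1).comp Primrec.id Primrec.id
  refine (PrimrecPred.and (Primrec.nat_le.comp (Primrec.const 2) Primrec.id) h2).of_eq ?_
  intro p
  rw [Nat.prime_def_lt]
  simp only [id, Nat.dvd_iff_mod_eq_zero, imp_iff_not_or]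

end Comp

/-- The `i`-th binary digit. -/
def bt (M i : ℕ) : ℕ := M / 2 ^ i % 2

/-- The number coding the prefix of length `n`. -/
def pre (y : ℕ → ℕ) (n : ℕ) : ℕ := ∑ i ∈ Finset.range n, y i * 2 ^ i

/-- exponent of the number of evaluation points -/
def tE (a g m : ℕ) : ℕ := a * m + a + 2 * g
/-- length of a code block -/
def rL (a g m : ℕ) : ℕ := 2 ^ (tE a g m) * 2 ^ (tE a g m + 1)
/-- message length -/
def dL (a m : ℕ) : ℕ := 2 ^ (a * m + a)
/-- the prime -/
def pr (a g m : ℕ) : ℕ := Nat.findGreatest Nat.Prime (2 * 2 ^ (tE a g m))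
/-- evaluation of the polynomial with coefficients the digits of `M` -/
def ev (d M x : ℕ) : ℕ := ∑ i ∈ Finset.range d, bt M i * x ^ i
/-- Hadamard exponent -/
def had (s v b : ℕ) : ℕ := ∑ i ∈ Finset.range s, bt v i * bt b i
/-- the code: bit `u` of the encoding of `M` -/
def enc (a g m M u : ℕ) : ℕ :=
  had (tE a g m + 1) (ev (dL a m) M (u / 2 ^ (tE a g m + 1)) % pr a g m)
    (u % 2 ^ (tE a g m + 1)) % 2
/-- number of agreements on block `j` -/
def cnt (a g m j X M : ℕ) : ℕ :=
  ∑ u ∈ Finset.range (rL a g m), if enc a g m M u = bt X (j * rL a g m + u) then 1 else 0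
/-- few agreements -/
def bad (a g m j X M : ℕ) : Prop :=
  2 * 2 ^ g * cnt a g m j X M + 2 * rL a g m < 2 ^ g * rL a g m
instance (a g m j X M : ℕ) : Decidable (bad a g m j X M) := by unfold bad; infer_instance
/-- list of bad messages -/
def badList (a g m j X : ℕ) : List ℕ :=
  (List.range (2 ^ dL a m)).filter fun M => decide (bad a g m j X M)
/-- decoder -/
def dec (a g m j i X : ℕ) : ℕ := ((badList a g m j X)[i]?).getD 0
/-- index of the large block -/
def mOf (a g t : ℕ) : ℕ := Nat.findGreatest (fun m => 2 ^ g * rL a g m ≤ t) t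
/-- message block index -/
def mI (a q : ℕ) : ℕ := Nat.findGreatest (fun m => 2 ^ (a * m) ≤ q) q

/-- The new sequence. -/
def newY (a g : ℕ) (y : ℕ → ℕ) (t : ℕ) : ℕ :=
  enc a g (mOf a g t) (pre y (dL a (mOf a g t))) (t % rL a g (mOf a g t))

/-- The predictor obtained by decoding. -/
def newX (a g j i : ℕ) (x : ℕ → ℕ) (q : ℕ) : ℕ :=
  1 - bt (dec a g (mI a q) j i (pre x ((j + 1) * rL a g (mI a q)))) q

section Comp2

variable {α : Type*} [Primcodable α]

theorem pr_bt {f h : α → ℕ} (hf : Primrec f) (hh : Primrec h) : Primrec fun x => bt (f x) (h x) :=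
  Primrec.nat_mod.comp (Primrec.nat_div.comp hf (primrec_pow (Primrec.const 2) hh))
    (Primrec.const 2)

theorem pr_tE (a g : ℕ) {f : α → ℕ} (hf : Primrec f) : Primrec fun x => tE a g (f x) :=
  Primrec.nat_add.comp (Primrec.nat_add.comp (Primrec.nat_mul.comp (Primrec.const a) hf)
    (Primrec.const a)) (Primrec.const _)

theorem pr_rL (a g : ℕ) {f : α → ℕ} (hf : Primrec f) : Primrec fun x => rL a g (f x) :=
  Primrec.nat_mul.comp (primrec_pow (Primrec.const 2) (pr_tE a g hf))
    (primrec_pow (Primrec.const 2) (Primrec.nat_add.comp (pr_tE a g hf) (Primrec.const 1)))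

theorem pr_dL (a : ℕ) {f : α → ℕ} (hf : Primrec f) : Primrec fun x => dL a (f x) :=
  primrec_pow (Primrec.const 2) (Primrec.nat_add.comp (Primrec.nat_mul.comp (Primrec.const a) hf)
    (Primrec.const a))

theorem pr_pr (a g : ℕ) {f : α → ℕ} (hf : Primrec f) : Primrec fun x => pr a g (f x) :=
  Primrec.nat_findGreatest (p := fun (_ : α) n => Nat.Prime n)
    (Primrec.nat_mul.comp (Primrec.const 2) (primrec_pow (Primrec.const 2) (pr_tE a g hf)))
    (primrec_prime.comp Primrec.snd)

theorem pr_ev {d M x : α → ℕ} (hd : Primrec d) (hM : Primrec M) (hx : Primrec x) :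
    Primrec fun z => ev (d z) (M z) (x z) :=
  primrec_sum (f := fun z i => bt (M z) i * x z ^ i)
    (Primrec.nat_mul.comp (pr_bt (hM.comp Primrec.fst) Primrec.snd)
      (primrec_pow (hx.comp Primrec.fst) Primrec.snd)).to₂ hd

theorem pr_had {d M x : α → ℕ} (hd : Primrec d) (hM : Primrec M) (hx : Primrec x) :
    Primrec fun z => had (d z) (M z) (x z) :=
  primrec_sum (f := fun z i => bt (M z) i * bt (x z) i)
    (Primrec.nat_mul.comp (pr_bt (hM.comp Primrec.fst) Primrec.snd)
      (pr_bt (hx.comp Primrec.fst) Primrec.snd)).to₂ hd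

theorem pr_enc (a g : ℕ) {m M u : α → ℕ} (hm : Primrec m) (hM : Primrec M) (hu : Primrec u) :
    Primrec fun z => enc a g (m z) (M z) (u z) := by
  have hs : Primrec fun z => tE a g (m z) + 1 := Primrec.succ.comp (pr_tE a g hm)
  have h2 := primrec_pow (Primrec.const 2) hs
  exact Primrec.nat_mod.comp (pr_had hs
    (Primrec.nat_mod.comp (pr_ev (pr_dL a hm) hM (Primrec.nat_div.comp hu h2)) (pr_pr a g hm))
    (Primrec.nat_mod.comp hu h2)) (Primrec.const 2)

theorem pr_cnt (a g j : ℕ) {m X M : α → ℕ} (hm : Primrec m) (hX : Primrec X) (hM : Primrec M) :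
    Primrec fun z => cnt a g (m z) j (X z) (M z) := by
  refine primrec_sum (f := fun z u => if enc a g (m z) (M z) u =
    bt (X z) (j * rL a g (m z) + u) then 1 else 0) ?_ (pr_rL a g hm)
  refine Primrec.ite (Primrec.eq.comp (pr_enc a g (hm.comp Primrec.fst) (hM.comp Primrec.fst)
    Primrec.snd) (pr_bt (hX.comp Primrec.fst) (Primrec.nat_add.comp (Primrec.nat_mul.comp
      (Primrec.const j) (pr_rL a g (hm.comp Primrec.fst))) Primrec.snd))) (Primrec.const 1)
      (Primrec.const 0)

theorem pr_bad (a g j : ℕ) {m X M : α → ℕ} (hm : Primrec m) (hX : Primrec X) (hM : Primrec M) :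
    PrimrecPred fun z => bad a g (m z) j (X z) (M z) :=
  Primrec.nat_lt.comp (Primrec.nat_add.comp (Primrec.nat_mul.comp (Primrec.const _)
    (pr_cnt a g j hm hX hM)) (Primrec.nat_mul.comp (Primrec.const 2) (pr_rL a g hm)))
    (Primrec.nat_mul.comp (Primrec.const _) (pr_rL a g hm))

theorem pr_dec (a g j i : ℕ) : Primrec₂ fun m X : ℕ => dec a g m j i X := by
  have h1 : PrimrecRel fun (M : ℕ) (z : ℕ × ℕ) => bad a g z.1 j z.2 M :=
    pr_bad a g j (Primrec.fst.comp Primrec.snd) (Primrec.snd.comp Primrec.snd) Primrec.fst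
  have h2 : Primrec fun z : ℕ × ℕ => badList a g z.1 j z.2 :=
    (PrimrecRel.listFilter h1).comp (Primrec.list_range.comp
      (primrec_pow (Primrec.const 2) (pr_dL a Primrec.fst))) Primrec.id
  exact Primrec.option_getD.comp (Primrec.list_getElem?.comp h2 (Primrec.const i))
    (Primrec.const 0)

theorem pr_mOf (a g : ℕ) : Primrec fun t => mOf a g t :=
  Primrec.nat_findGreatest (p := fun t m => 2 ^ g * rL a g m ≤ t) Primrec.id
    (Primrec.nat_le.comp (Primrec.nat_mul.comp (Primrec.const _) (pr_rL a g Primrec.snd))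
      Primrec.fst)

theorem pr_mI (a : ℕ) : Primrec fun t => mI a t :=
  Primrec.nat_findGreatest (p := fun t m => 2 ^ (a * m) ≤ t) Primrec.id
    (Primrec.nat_le.comp (primrec_pow (Primrec.const 2) (Primrec.nat_mul.comp (Primrec.const _)
      Primrec.snd)) Primrec.fst)

theorem comp_pre {x : ℕ → ℕ} (hx : Computable x) : Computable fun n => pre x n :=
  computable_sum (Primrec.nat_mul.to_comp.comp hx
    (primrec_pow (Primrec.const 2) Primrec.id).to_comp)

theorem comp_newX (a g j i : ℕ) {x : ℕ → ℕ} (hx : Computable x) : Computable (newX a g j i x) := by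
  have h1 : Computable fun q => pre x ((j + 1) * rL a g (mI a q)) :=
    (comp_pre hx).comp (Primrec.nat_mul.comp (Primrec.const _) (pr_rL a g (pr_mI a))).to_comp
  have h2 : Computable fun q => dec a g (mI a q) j i (pre x ((j + 1) * rL a g (mI a q))) :=
    (pr_dec a g j i).to_comp.comp (pr_mI a).to_comp h1
  have h3 : Computable₂ fun M q => 1 - bt M q :=
    (Primrec.nat_sub.comp (Primrec.const 1) (pr_bt Primrec.fst Primrec.snd)).to_comp
  exact h3.comp h2 Computable.id

theorem newX_bit (a g j i : ℕ) (x : ℕ → ℕ) : IsBitSeq (newX a g j i x) := fun n => by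
  unfold newX; omega

theorem newY_bit (a g : ℕ) (x : ℕ → ℕ) : IsBitSeq (newY a g x) := fun n =>
  Nat.mod_lt _ (by norm_num)

end Comp2

/-! ### Oracle codes -/

/-- Embedding of ordinary codes. -/
def emb : Nat.Partrec.Code → OracleCode
  | .zero => .zero
  | .succ => .succ
  | .left => .left
  | .right => .right
  | .pair f g => .pair (emb f) (emb g)
  | .comp f g => .comp (emb f) (emb g)
  | .prec f g => .prec (emb f) (emb g)
  | .rfind' f => .rfind' (emb f)

theorem emb_eval (A : ℕ → ℕ) (c : Nat.Partrec.Code) : (emb c).eval A = c.eval := by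
  induction c with
  | zero => rfl
  | succ => rfl
  | left => rfl
  | right => rfl
  | pair f g hf hg => simp only [emb, OracleCode.eval, Nat.Partrec.Code.eval, hf, hg]; rfl
  | comp f g hf hg => simp only [emb, OracleCode.eval, Nat.Partrec.Code.eval, hf, hg]; rfl
  | prec f g hf hg => simp only [emb, OracleCode.eval, Nat.Partrec.Code.eval, hf, hg]; rfl
  | rfind' f hf => simp only [emb, OracleCode.eval, Nat.Partrec.Code.eval, hf]; rfl

theorem eval_comp {A : ℕ → ℕ} {f g : OracleCode} {n u : ℕ} (hg : g.eval A n = Part.some u) :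
    (OracleCode.comp f g).eval A n = f.eval A u := by
  rw [OracleCode.eval]
  have : (g.eval A n).bind (f.eval A) = f.eval A u := by
    rw [hg]; exact Part.bind_some _ _
  exact this

theorem eval_pair {A : ℕ → ℕ} {f g : OracleCode} {n u v : ℕ} (hf : f.eval A n = Part.some u)
    (hg : g.eval A n = Part.some v) :
    (OracleCode.pair f g).eval A n = Part.some (Nat.pair u v) := by
  rw [OracleCode.eval]
  simp only [hf, hg]
  simp [Seq.seq]

theorem exists_code (A : ℕ → ℕ) {f : ℕ → ℕ} (hf : Primrec f) :
    ∃ c : OracleCode, ∀ n, c.eval A n = Part.some (f n) := by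
  have h : Nat.Partrec (f : ℕ →. ℕ) := Partrec.nat_iff.1 hf.to_comp
  obtain ⟨c, hc⟩ := Nat.Partrec.Code.exists_code.1 h
  exact ⟨emb c, fun n => by rw [emb_eval, hc]; rfl⟩

theorem turing_pre {A y : ℕ → ℕ} (hy : TuringLE y A) {b : ℕ → ℕ} (hb : Primrec b)
    {E : ℕ → ℕ → ℕ} (hE : Primrec₂ E) : TuringLE (fun t => E t (pre y (b t))) A := by
  obtain ⟨c, hc⟩ := hy
  obtain ⟨cb, hcb⟩ := exists_code A (f := fun n => Nat.pair 0 (b n))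
    (Primrec₂.natPair.comp (Primrec.const 0) hb)
  obtain ⟨cid, hcid⟩ := exists_code A (f := fun n => n) Primrec.id
  obtain ⟨ck, hck⟩ := exists_code A (f := fun n => n.unpair.2.unpair.1)
    (Primrec.fst.comp (Primrec.unpair.comp (Primrec.snd.comp Primrec.unpair)))
  obtain ⟨cs, hcs⟩ := exists_code A
    (f := fun n => n.unpair.1.unpair.2.unpair.2 + n.unpair.2 * 2 ^ n.unpair.1.unpair.2.unpair.1) (by
      have h1 : Primrec fun n : ℕ => n.unpair.1 := Primrec.fst.comp Primrec.unpair
      have h2 : Primrec fun n : ℕ => n.unpair.2 := Primrec.snd.comp Primrec.unpair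
      exact Primrec.nat_add.comp (h2.comp (h2.comp h1)) (Primrec.nat_mul.comp h2
        (primrec_pow (Primrec.const 2) (h1.comp (h2.comp h1)))))
  obtain ⟨cE, hcE⟩ := exists_code A (f := fun n => E n.unpair.1 n.unpair.2)
    (hE.comp (Primrec.fst.comp Primrec.unpair) (Primrec.snd.comp Primrec.unpair))
  have hstep : ∀ k i, OracleCode.eval A (.comp cs (.pair cid (.comp c ck)))
      (Nat.pair 0 (Nat.pair k i)) = Part.some (i + y k * 2 ^ k) := by
    intro k i
    have h1 := eval_comp (f := c) (hck (Nat.pair 0 (Nat.pair k i)))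
    rw [hc] at h1
    rw [eval_comp (eval_pair (hcid _) h1), hcs]
    simp
  have hpre : ∀ n, OracleCode.eval A (.prec .zero (.comp cs (.pair cid (.comp c ck))))
      (Nat.pair 0 n) = Part.some (pre y n) := by
    intro n
    induction n with
    | zero => simp [OracleCode.eval, pre, Nat.unpaired]; rfl
    | succ n ih =>
      rw [OracleCode.eval] at ih ⊢
      simp only [Nat.unpaired, Nat.unpair_pair] at ih ⊢
      rw [ih]
      have := hstep n (pre y n)
      simp only [Part.bind_eq_bind, Part.bind_some]
      rw [this, pre, pre, Finset.sum_range_succ]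
  refine ⟨.comp cE (.pair cid (.comp (.prec .zero (.comp cs (.pair cid (.comp c ck)))) cb)),
    fun n => ?_⟩
  have h1 : OracleCode.eval A (.comp (.prec .zero (.comp cs (.pair cid (.comp c ck)))) cb) n
      = Part.some (pre y (b n)) := by
    rw [eval_comp (hcb n)]
    exact hpre _
  rw [eval_comp (eval_pair (hcid n) h1), hcE, Nat.unpair_pair]

theorem newY_le (a g : ℕ) {A y : ℕ → ℕ} (hy : TuringLE y A) : TuringLE (newY a g y) A :=
  turing_pre hy (pr_dL a (pr_mOf a g))
    (E := fun t P => enc a g (mOf a g t) P (t % rL a g (mOf a g t)))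
    (pr_enc a g ((pr_mOf a g).comp Primrec.fst) Primrec.snd
      (Primrec.nat_mod.comp Primrec.fst (pr_rL a g ((pr_mOf a g).comp Primrec.fst))))

/-! ### Binary digits -/

theorem bt_lt (M i : ℕ) : bt M i < 2 := Nat.mod_lt _ (by norm_num)

theorem bt_toNat (M i : ℕ) : bt M i = (M.testBit i).toNat := by
  rw [Nat.toNat_testBit]; rfl

theorem eq_of_bt {d M N : ℕ} (hM : M < 2 ^ d) (hN : N < 2 ^ d)
    (h : ∀ i < d, bt M i = bt N i) : M = N := by
  apply Nat.eq_of_testBit_eq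
  intro i
  by_cases hi : i < d
  · have := h i hi
    rw [bt_toNat, bt_toNat] at this
    revert this
    cases M.testBit i <;> cases N.testBit i <;> simp
  · push Not at hi
    have h2 : 2 ^ d ≤ 2 ^ i := Nat.pow_le_pow_right (by norm_num) hi
    rw [Nat.testBit_lt_two_pow (by omega), Nat.testBit_lt_two_pow (by omega)]

theorem bt_add_mul (P c : ℕ) {n i : ℕ} (hi : i < n) : bt (P + c * 2 ^ n) i = bt P i := by
  obtain ⟨k, rfl⟩ := Nat.exists_eq_add_of_lt hi
  unfold bt
  have : P + c * 2 ^ (i + k + 1) = P + 2 ^ i * (2 * (c * 2 ^ k)) := by ring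
  rw [this, Nat.add_mul_div_left _ _ (by positivity), Nat.add_mul_mod_self_left]

theorem bt_top {P c n : ℕ} (hP : P < 2 ^ n) (hc : c < 2) : bt (P + c * 2 ^ n) n = c := by
  unfold bt
  rw [Nat.add_mul_div_right _ _ (by positivity), Nat.div_eq_of_lt hP, zero_add,
    Nat.mod_eq_of_lt hc]

theorem bt_zero_of_lt {P n : ℕ} (hP : P < 2 ^ n) : bt P n = 0 := by
  unfold bt; rw [Nat.div_eq_of_lt hP]

theorem pre_succ (y : ℕ → ℕ) (n : ℕ) : pre y (n + 1) = pre y n + y n * 2 ^ n :=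
  Finset.sum_range_succ _ _

theorem pre_lt {y : ℕ → ℕ} (hy : IsBitSeq y) (n : ℕ) : pre y n < 2 ^ n := by
  induction n with
  | zero => simp [pre]
  | succ n ih =>
    rw [pre_succ, pow_succ]
    have := hy n
    have : y n * 2 ^ n ≤ 1 * 2 ^ n := Nat.mul_le_mul_right _ (by omega)
    omega

theorem bt_pre {y : ℕ → ℕ} (hy : IsBitSeq y) {n i : ℕ} (hi : i < n) : bt (pre y n) i = y i := by
  induction n with
  | zero => omega
  | succ n ih =>
    rw [pre_succ]
    by_cases h : i < n
    · rw [bt_add_mul _ _ h, ih h]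
    · have : i = n := by omega
      subst this
      exact bt_top (pre_lt hy _) (hy _)

/-! ### Hadamard code -/

theorem had_sum (s v w : ℕ) : ∑ b ∈ Finset.range (2 ^ s), (-1 : ℤ) ^ (had s v b + had s w b)
    = ∏ i ∈ Finset.range s, (1 + (-1 : ℤ) ^ (bt v i + bt w i)) := by
  induction s with
  | zero => simp [had]
  | succ s ih =>
    have hs : ∀ v b, had (s + 1) v b = had s v b + bt v s * bt b s := fun v b =>
      Finset.sum_range_succ _ _
    have h1 : ∀ v b, had s v (2 ^ s + b) = had s v b := by
      intro v b
      apply Finset.sum_congr rfl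
      intro i hi
      have := bt_add_mul b 1 (Finset.mem_range.1 hi)
      rw [one_mul, add_comm] at this
      rw [this]
    have h2 : ∀ b < 2 ^ s, bt (2 ^ s + b) s = 1 := by
      intro b hb
      have := bt_top hb (c := 1) (by norm_num)
      rwa [one_mul, add_comm] at this
    rw [pow_succ, mul_two, Finset.sum_range_add, Finset.prod_range_succ, ← ih, mul_add, mul_one]
    congr 1
    · apply Finset.sum_congr rfl
      intro b hb
      rw [hs, hs, bt_zero_of_lt (Finset.mem_range.1 hb)]
      simp
    · rw [Finset.sum_mul]
      apply Finset.sum_congr rfl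
      intro b hb
      rw [hs, hs, h1, h1, h2 b (Finset.mem_range.1 hb), ← pow_add]
      congr 1
      ring

theorem had_orth {s v w : ℕ} (hv : v < 2 ^ s) (hw : w < 2 ^ s) (h : v ≠ w) :
    ∑ b ∈ Finset.range (2 ^ s), (-1 : ℤ) ^ (had s v b + had s w b) = 0 := by
  rw [had_sum]
  have : ∃ i < s, bt v i ≠ bt w i := by
    by_contra! hc
    exact h (eq_of_bt hv hw hc)
  obtain ⟨i, hi, hne⟩ := this
  apply Finset.prod_eq_zero (Finset.mem_range.2 hi)
  have h1 := bt_lt v i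
  have h2 := bt_lt w i
  have : bt v i + bt w i = 1 := by omega
  rw [this]; norm_num

/-! ### Polynomial evaluation -/

theorem ev_roots {d M N p T : ℕ} (hp : p.Prime) (hT : T ≤ p) (hM : M < 2 ^ d) (hN : N < 2 ^ d)
    (h : M ≠ N) :
    ((Finset.range T).filter fun x => ev d M x % p = ev d N x % p).card ≤ d := by
  classical
  have := Fact.mk hp
  obtain ⟨i, hi, hne⟩ : ∃ i < d, bt M i ≠ bt N i := by
    by_contra! hc
    exact h (eq_of_bt hM hN hc)
  let P : Polynomial (ZMod p) := ∑ i ∈ Finset.range d,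
    Polynomial.C ((bt M i : ZMod p) - (bt N i : ZMod p)) * Polynomial.X ^ i
  have hcoef : P.coeff i = (bt M i : ZMod p) - (bt N i : ZMod p) := by
    simp only [P, Polynomial.finsetSum_coeff, Polynomial.coeff_C_mul_X_pow]
    rw [Finset.sum_eq_single i]
    · simp
    · intro b _ hb
      rw [if_neg (Ne.symm hb)]
    · intro hc; exact absurd (Finset.mem_range.2 hi) hc
  have hP : P ≠ 0 := by
    intro h0
    rw [h0, Polynomial.coeff_zero] at hcoef
    have h1 := bt_lt M i
    have h2 := bt_lt N i
    have h3 := sub_eq_zero.1 hcoef.symm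
    rw [ZMod.natCast_eq_natCast_iff'] at h3
    have := hp.two_le
    rw [Nat.mod_eq_of_lt (by omega), Nat.mod_eq_of_lt (by omega)] at h3
    exact hne h3
  have hdeg : P.natDegree ≤ d := by
    apply Polynomial.natDegree_sum_le_of_forall_le
    intro j hj
    exact (Polynomial.natDegree_C_mul_X_pow_le _ _).trans (Finset.mem_range.1 hj).le
  have heval : ∀ x : ℕ, P.eval (x : ZMod p) = ((ev d M x : ℕ) : ZMod p) - ((ev d N x : ℕ) : ZMod p) := by
    intro x
    simp only [P, ev, Polynomial.eval_finsetSum]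
    push_cast
    rw [← Finset.sum_sub_distrib]
    apply Finset.sum_congr rfl
    intro j _
    simp [sub_mul]
  refine le_trans ?_ ((Multiset.toFinset_card_le _).trans ((Polynomial.card_roots' P).trans hdeg))
  apply Finset.card_le_card_of_injOn (fun x : ℕ => (x : ZMod p))
  · intro x hx
    simp only [Finset.coe_filter, Finset.mem_range, Set.mem_ofPred_eq] at hx
    simp only [Finset.mem_coe, Multiset.mem_toFinset]
    rw [Polynomial.mem_roots hP, Polynomial.IsRoot.def, heval, sub_eq_zero,
      ZMod.natCast_eq_natCast_iff']
    exact hx.2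
  · intro x hx y hy hxy
    simp only [Finset.coe_filter, Finset.mem_range, Set.mem_ofPred_eq] at hx hy
    simp only at hxy
    rw [ZMod.natCast_eq_natCast_iff', Nat.mod_eq_of_lt (by omega), Nat.mod_eq_of_lt (by omega)]
      at hxy
    exact hxy

theorem sum_range_mul' (f : ℕ → ℤ) (T S : ℕ) : ∑ u ∈ Finset.range (T * S), f u
    = ∑ x ∈ Finset.range T, ∑ b ∈ Finset.range S, f (x * S + b) := by
  induction T with
  | zero => simp
  | succ T ih => rw [add_mul, one_mul, Finset.sum_range_add, ih, Finset.sum_range_succ]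

theorem pr_spec (a g m : ℕ) : (pr a g m).Prime ∧ 2 ^ tE a g m < pr a g m ∧
    pr a g m ≤ 2 ^ (tE a g m + 1) := by
  obtain ⟨p, hp, h1, h2⟩ := Nat.exists_prime_lt_and_le_two_mul (2 ^ tE a g m) (by positivity)
  refine ⟨Nat.findGreatest_spec h2 hp, lt_of_lt_of_le h1 (Nat.le_findGreatest h2 hp), ?_⟩
  rw [pow_succ, mul_comm]
  exact Nat.findGreatest_le _

theorem enc_corr (a g m : ℕ) {M N : ℕ} (hM : M < 2 ^ dL a m) (hN : N < 2 ^ dL a m) (h : M ≠ N) :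
    ∑ u ∈ Finset.range (rL a g m), (-1 : ℤ) ^ enc a g m M u * (-1 : ℤ) ^ enc a g m N u
      ≤ dL a m * 2 ^ (tE a g m + 1) := by
  obtain ⟨hp, hT, hS⟩ := pr_spec a g m
  have hr := ev_roots hp hT.le hM hN h
  rw [rL, sum_range_mul']
  have key : ∀ x, ∑ b ∈ Finset.range (2 ^ (tE a g m + 1)),
      (-1 : ℤ) ^ enc a g m M (x * 2 ^ (tE a g m + 1) + b) *
      (-1 : ℤ) ^ enc a g m N (x * 2 ^ (tE a g m + 1) + b)
      = if ev (dL a m) M x % pr a g m = ev (dL a m) N x % pr a g m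
        then (2 ^ (tE a g m + 1) : ℤ) else 0 := by
    intro x
    have h1 : ∀ b ∈ Finset.range (2 ^ (tE a g m + 1)),
      (-1 : ℤ) ^ enc a g m M (x * 2 ^ (tE a g m + 1) + b) *
      (-1 : ℤ) ^ enc a g m N (x * 2 ^ (tE a g m + 1) + b) = (-1 : ℤ) ^
        (had (tE a g m + 1) (ev (dL a m) M x % pr a g m) b +
         had (tE a g m + 1) (ev (dL a m) N x % pr a g m) b) := by
      intro b hb
      have hb := Finset.mem_range.1 hb
      have e1 : (x * 2 ^ (tE a g m + 1) + b) / 2 ^ (tE a g m + 1) = x := by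
        rw [mul_comm, Nat.mul_add_div (by positivity), Nat.div_eq_of_lt hb, add_zero]
      have e2 : (x * 2 ^ (tE a g m + 1) + b) % 2 ^ (tE a g m + 1) = b := by
        rw [mul_comm, Nat.mul_add_mod, Nat.mod_eq_of_lt hb]
      unfold enc
      rw [e1, e2, ← neg_one_pow_eq_pow_mod_two, ← neg_one_pow_eq_pow_mod_two, pow_add]
    rw [Finset.sum_congr rfl h1]
    split_ifs with hc
    · rw [hc]
      simp [← two_mul]
    · exact had_orth ((Nat.mod_lt _ hp.pos).trans_le hS) ((Nat.mod_lt _ hp.pos).trans_le hS) hc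
  rw [Finset.sum_congr rfl fun x _ => key x, ← Finset.sum_filter, Finset.sum_const, nsmul_eq_mul]
  gcongr

/-! ### List decoding bound -/

theorem johnson (a g m j X : ℕ) : (badList a g m j X).length ≤ 4 ^ g := by
  classical
  set r := rL a g m with hr
  let F : Finset ℕ := (Finset.range (2 ^ dL a m)).filter fun M => bad a g m j X M
  have hlen : (badList a g m j X).length = F.card := by
    rfl
  rw [hlen]
  let c : ℕ → ℕ → ℤ := fun M u => (-1 : ℤ) ^ enc a g m M u
  let ξ : ℕ → ℤ := fun u => (-1 : ℤ) ^ bt X (j * r + u)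
  have hrpos : 0 < r := by rw [hr, rL]; positivity
  have hξ : ∀ u, ξ u ^ 2 = 1 := fun u => by
    simp only [ξ]; rw [← pow_mul, mul_comm, pow_mul]; norm_num
  have hcc : ∀ M u, c M u ^ 2 = 1 := fun M u => by
    simp only [c]; rw [← pow_mul, mul_comm, pow_mul]; norm_num
  have hcnt : ∀ M, ∑ u ∈ Finset.range r, ξ u * c M u = 2 * cnt a g m j X M - r := by
    intro M
    have : ∀ u, ξ u * c M u =
        2 * ((if enc a g m M u = bt X (j * r + u) then 1 else 0 : ℕ) : ℤ) - 1 := by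
      intro u
      have h1 := bt_lt X (j * r + u)
      have h2 : enc a g m M u < 2 := Nat.mod_lt _ (by norm_num)
      simp only [ξ, c]
      generalize enc a g m M u = p at *
      generalize bt X (j * r + u) = q at *
      interval_cases p <;> interval_cases q <;> simp
    rw [Finset.sum_congr rfl fun u _ => this u, Finset.sum_sub_distrib, ← Finset.mul_sum,
      ← Nat.cast_sum]
    simp [cnt, hr]
  have hbad : ∀ M ∈ F, 2 * (r : ℤ) ≤ 2 ^ g * -(∑ u ∈ Finset.range r, ξ u * c M u) := by
    intro M hM
    have hb := (Finset.mem_filter.1 hM).2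
    unfold bad at hb
    rw [hcnt]
    have : (2 * 2 ^ g * cnt a g m j X M + 2 * r : ℤ) < 2 ^ g * r := by exact_mod_cast hb
    linarith
  have hsum : 2 * (r : ℤ) * F.card ≤ 2 ^ g *
      -(∑ u ∈ Finset.range r, ξ u * ∑ M ∈ F, c M u) := by
    have h1 := Finset.sum_le_sum hbad
    rw [Finset.sum_const, ← Finset.mul_sum, Finset.sum_neg_distrib, Finset.sum_comm] at h1
    simp only [← Finset.mul_sum] at h1
    rw [nsmul_eq_mul] at h1
    linarith
  have hcs := Finset.sum_mul_sq_le_sq_mul_sq (Finset.range r) ξ (fun u => ∑ M ∈ F, c M u)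
  rw [Finset.sum_congr rfl fun u _ => hξ u] at hcs
  simp only [Finset.sum_const, Finset.card_range, nsmul_eq_mul, mul_one] at hcs
  have hsq : ∑ u ∈ Finset.range r, (∑ M ∈ F, c M u) ^ 2
      ≤ F.card * r + F.card * F.card * (dL a m * 2 ^ (tE a g m + 1)) := by
    have e : ∑ u ∈ Finset.range r, (∑ M ∈ F, c M u) ^ 2
        = ∑ M ∈ F, ∑ N ∈ F, ∑ u ∈ Finset.range r, c M u * c N u := by
      simp only [sq, Finset.sum_mul_sum]
      rw [Finset.sum_comm]
      apply Finset.sum_congr rfl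
      intro M _
      rw [Finset.sum_comm]
    rw [e]
    have b1 : ∀ M ∈ F, ∀ N ∈ F, ∑ u ∈ Finset.range r, c M u * c N u
        ≤ (if M = N then (r : ℤ) else 0) + dL a m * 2 ^ (tE a g m + 1) := by
      intro M hM N hN
      split_ifs with hMN
      · subst hMN
        have : ∑ u ∈ Finset.range r, c M u * c M u = r := by
          rw [Finset.sum_congr rfl fun u _ => (sq (c M u)).symm.trans (hcc M u)]
          simp
        rw [this]
        have : (0 : ℤ) ≤ dL a m * 2 ^ (tE a g m + 1) := by positivity
        linarith
      · rw [zero_add]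
        exact enc_corr a g m (Finset.mem_range.1 (Finset.mem_filter.1 hM).1)
          (Finset.mem_range.1 (Finset.mem_filter.1 hN).1) hMN
    refine (Finset.sum_le_sum fun M hM => Finset.sum_le_sum fun N hN => b1 M hM N hN).trans ?_
    apply le_of_eq
    simp only [Finset.sum_add_distrib, Finset.sum_ite_eq, Finset.sum_const, nsmul_eq_mul]
    rw [Finset.sum_congr rfl (g := fun _ => (r : ℤ)) fun M hM => if_pos hM]
    simp
    ring
  have hrd : (2 ^ g : ℤ) ^ 2 * (dL a m * 2 ^ (tE a g m + 1)) = r := by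
    rw [hr, rL, dL]
    push_cast
    have : tE a g m = (a * m + a) + 2 * g := rfl
    rw [this, pow_add 2 (a * m + a) (2 * g)]
    ring
  set L : ℤ := (F.card : ℤ) with hL
  set W := ∑ u ∈ Finset.range r, ξ u * ∑ M ∈ F, c M u with hW
  set B : ℤ := 2 ^ g with hB
  have hL0 : 0 ≤ L := by positivity
  have hr0 : (0 : ℤ) < r := by exact_mod_cast hrpos
  have s1 : (2 * r * L) ^ 2 ≤ (B * -W) ^ 2 :=
    pow_le_pow_left₀ (by positivity) hsum 2
  have s2 : (B * -W) ^ 2 ≤ B ^ 2 * (r * (L * r + L * L * (dL a m * 2 ^ (tE a g m + 1)))) := by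
    have : (B * -W) ^ 2 = B ^ 2 * W ^ 2 := by ring
    rw [this]
    apply mul_le_mul_of_nonneg_left _ (by positivity)
    exact hcs.trans (mul_le_mul_of_nonneg_left hsq hr0.le)
  have s3 : (r : ℤ) ^ 2 * (4 * L ^ 2) ≤ r ^ 2 * (B ^ 2 * L + L ^ 2) := by
    calc (r : ℤ) ^ 2 * (4 * L ^ 2) = (2 * r * L) ^ 2 := by ring
      _ ≤ _ := s1.trans s2
      _ = B ^ 2 * r ^ 2 * L + r * L ^ 2 * (B ^ 2 * (dL a m * 2 ^ (tE a g m + 1))) := by ring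
      _ = _ := by rw [hrd]; ring
  have s4 : 4 * L ^ 2 ≤ B ^ 2 * L + L ^ 2 := le_of_mul_le_mul_left s3 (by positivity)
  have s5 : L ≤ B ^ 2 := by
    by_contra! hc
    nlinarith [sq_nonneg B]
  have : ((4 ^ g : ℕ) : ℤ) = B ^ 2 := by
    rw [hB, ← pow_mul, mul_comm, pow_mul]; norm_num
  rw [← this] at s5
  exact Int.ofNat_le.1 s5

/-! ### Densities -/

/-- counting function of a set -/
noncomputable def cz (z : Set ℕ) (n : ℕ) : ℕ := Nat.card ↥(z ∩ Set.Iio n)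

theorem cz_eq (z : Set ℕ) [DecidablePred (· ∈ z)] (n : ℕ) :
    cz z n = ((Finset.range n).filter (· ∈ z)).card := by
  unfold cz
  rw [← Nat.card_eq_finsetCard]
  apply Nat.card_congr
  apply Equiv.subtypeEquivRight
  intro x
  simp [and_comm]

theorem cz_le (z : Set ℕ) (n : ℕ) : cz z n ≤ n := by
  classical
  rw [cz_eq]
  exact (Finset.card_filter_le _ _).trans (by simp)

theorem ratio_nonneg (z : Set ℕ) (n : ℕ) : (0 : ℝ) ≤ (cz z n : ℝ) / n := by positivity

theorem ratio_le (z : Set ℕ) (n : ℕ) : (cz z n : ℝ) / n ≤ 1 := by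
  apply div_le_one_of_le₀ _ (by positivity)
  exact_mod_cast cz_le z n

theorem ld_eq (z : Set ℕ) : lowerDensity z = liminf (fun n => (cz z n : ℝ) / n) atTop := rfl

theorem ratio_bdd (z : Set ℕ) : IsBoundedUnder (· ≥ ·) atTop (fun n => (cz z n : ℝ) / n) :=
  isBoundedUnder_of ⟨0, fun n => ratio_nonneg z n⟩

theorem ratio_cobdd (z : Set ℕ) : IsCoboundedUnder (· ≥ ·) atTop (fun n => (cz z n : ℝ) / n) :=
  (isBoundedUnder_of ⟨1, fun n => ratio_le z n⟩ :
    IsBoundedUnder (· ≤ ·) atTop (fun n => (cz z n : ℝ) / n)).isCoboundedUnder_ge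

theorem le_ld {z : Set ℕ} {c : ℝ} (h : ∀ᶠ n in atTop, c * n ≤ cz z n) : c ≤ lowerDensity z := by
  rw [ld_eq]
  apply le_liminf_of_le (ratio_cobdd z)
  filter_upwards [h, eventually_gt_atTop 0] with n hn h0
  rwa [le_div_iff₀ (by exact_mod_cast h0)]

theorem ld_le {z : Set ℕ} {c : ℝ} (h : ∃ᶠ n in atTop, (cz z n : ℝ) ≤ c * n) :
    lowerDensity z ≤ c := by
  rw [ld_eq]
  apply liminf_le_of_frequently_le _ (ratio_bdd z)
  refine (h.and_eventually (eventually_gt_atTop 0)).mono ?_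
  rintro n ⟨hn, h0⟩
  rwa [div_le_iff₀ (by exact_mod_cast h0)]

theorem ld_nonneg (z : Set ℕ) : 0 ≤ lowerDensity z :=
  le_ld (Eventually.of_forall fun n => by simp)

theorem delta_le {Y x : ℕ → ℕ} (hx : IsBitSeq x) (hc : Computable x) :
    deltaVal Y ≤ lowerDensity (agree Y x) := by
  apply csInf_le
  · exact ⟨0, by rintro _ ⟨x, _, rfl⟩; exact ld_nonneg _⟩
  · exact ⟨x, ⟨hx, hc⟩, rfl⟩

theorem le_delta {Y : ℕ → ℕ} {c : ℝ}
    (h : ∀ x, IsBitSeq x → Computable x → c ≤ lowerDensity (agree Y x)) : c ≤ deltaVal Y := by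
  apply le_csInf
  · exact ⟨_, fun _ => 0, ⟨fun _ => by norm_num, Computable.const 0⟩, rfl⟩
  · rintro _ ⟨x, hx, rfl⟩
    exact h x hx.1 hx.2

theorem delta_le_half {Y : ℕ → ℕ} : deltaVal Y ≤ 1 / 2 := by
  classical
  have h0 : deltaVal Y ≤ lowerDensity (agree Y fun _ => 0) :=
    delta_le (fun _ => by norm_num) (Computable.const 0)
  have h1 : deltaVal Y ≤ lowerDensity (agree Y fun _ => 1) :=
    delta_le (fun _ => by norm_num) (Computable.const 1)
  have hs : ∀ n, cz (agree Y fun _ => 0) n + cz (agree Y fun _ => 1) n ≤ n := by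
    intro n
    rw [cz_eq, cz_eq, ← Finset.card_union_of_disjoint]
    · refine (Finset.card_le_card (t := Finset.range n) ?_).trans (by simp)
      intro x hx
      rcases Finset.mem_union.1 hx with h | h <;> exact (Finset.mem_filter.1 h).1
    · rw [Finset.disjoint_left]
      intro x hx hx2
      have a1 : Y x = 0 := (Finset.mem_filter.1 hx).2
      have a2 : Y x = 1 := (Finset.mem_filter.1 hx2).2
      omega
  by_cases hf : ∃ᶠ n in atTop, (cz (agree Y fun _ => 0) n : ℝ) ≤ 1 / 2 * n
  · exact h0.trans (ld_le hf)
  · refine h1.trans (ld_le (Eventually.frequently ?_))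
    rw [not_frequently] at hf
    filter_upwards [hf] with n hn
    push Not at hn
    have : (cz (agree Y fun _ => 0) n : ℝ) + cz (agree Y fun _ => 1) n ≤ n := by
      exact_mod_cast hs n
    linarith

/-! ### Blocks -/

theorem mI_eq {a m q : ℕ} (ha : 0 < a) (h1 : 2 ^ (a * m) ≤ q) (h2 : q < 2 ^ (a * m + a)) :
    mI a q = m := by
  unfold mI
  rw [Nat.findGreatest_eq_iff]
  refine ⟨?_, fun _ => h1, ?_⟩
  · have h3 : m ≤ a * m := Nat.le_mul_of_pos_left m ha
    have h4 : a * m < 2 ^ (a * m) := Nat.lt_two_pow_self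
    omega
  · intro n hn _ hc
    have h3 : a * m + a ≤ a * n := by
      have : a * (m + 1) ≤ a * n := Nat.mul_le_mul_left _ hn
      linarith
    have h4 : 2 ^ (a * m + a) ≤ 2 ^ (a * n) := Nat.pow_le_pow_right (by norm_num) h3
    omega

theorem rL_succ (a g m : ℕ) : rL a g (m + 1) = 4 ^ a * rL a g m := by
  unfold rL
  have : tE a g (m + 1) = tE a g m + a := by unfold tE; ring
  rw [this]
  have h4 : (4 : ℕ) ^ a = 2 ^ a * 2 ^ a := by rw [← mul_pow]; norm_num
  rw [h4]
  ring

theorem rL_pos (a g m : ℕ) : 0 < rL a g m := by unfold rL; positivity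

theorem rL_mono (a g : ℕ) : Monotone (rL a g) := by
  apply monotone_nat_of_le_succ
  intro n
  rw [rL_succ]
  exact Nat.le_mul_of_pos_left _ (by positivity)

theorem le_rL {a : ℕ} (ha : 0 < a) (g m : ℕ) : m < rL a g m := by
  unfold rL
  have h3 : m ≤ a * m := Nat.le_mul_of_pos_left m ha
  have h1 : m ≤ tE a g m := by unfold tE; omega
  have h4 : tE a g m < 2 ^ tE a g m := Nat.lt_two_pow_self
  have h5 : 2 ^ tE a g m ≤ 2 ^ tE a g m * 2 ^ (tE a g m + 1) :=
    Nat.le_mul_of_pos_right _ (by positivity)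
  omega

theorem mOf_eq {a g m t : ℕ} (ha : 0 < a) (h1 : 2 ^ g * rL a g m ≤ t)
    (h2 : t < 2 ^ g * rL a g (m + 1)) : mOf a g t = m := by
  unfold mOf
  rw [Nat.findGreatest_eq_iff]
  refine ⟨?_, fun _ => h1, ?_⟩
  · have := le_rL ha g m
    have h3 : rL a g m ≤ 2 ^ g * rL a g m := Nat.le_mul_of_pos_left _ (by positivity)
    omega
  · intro n hn _ hc
    have : 2 ^ g * rL a g (m + 1) ≤ 2 ^ g * rL a g n := Nat.mul_le_mul_left _ (rL_mono a g hn)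
    omega

/-- The decoder fails eventually. -/
theorem dec_fails {a g : ℕ} (ha : 0 < a) {y x : ℕ → ℕ} (hy : IsBitSeq y)
    (hxc : Computable x) (hδ : (1 / 2 : ℝ) ^ a < deltaVal y) (j i : ℕ) :
    ∀ᶠ m in atTop, dec a g m j i (pre x ((j + 1) * rL a g m)) ≠ pre y (dL a m) := by
  classical
  by_contra hc
  rw [not_eventually] at hc
  simp only [not_not] at hc
  have h1 := delta_le (Y := y) (newX_bit a g j i x) (comp_newX a g j i hxc)
  have h2 : lowerDensity (agree y (newX a g j i x)) ≤ (1 / 2 : ℝ) ^ a := by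
    apply ld_le
    rw [frequently_atTop] at hc ⊢
    intro n0
    obtain ⟨m, hm, hdec⟩ := hc n0
    refine ⟨2 ^ (a * m + a), ?_, ?_⟩
    · have h3 : m ≤ a * m := Nat.le_mul_of_pos_left m ha
      have h4 : a * m + a < 2 ^ (a * m + a) := Nat.lt_two_pow_self
      omega
    · have hle : cz (agree y (newX a g j i x)) (2 ^ (a * m + a)) ≤ 2 ^ (a * m) := by
        rw [cz_eq]
        refine (Finset.card_le_card (t := Finset.range (2 ^ (a * m))) ?_).trans (by simp)
        intro q hq
        obtain ⟨hq1, hq2⟩ := Finset.mem_filter.1 hq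
        rw [Finset.mem_range] at hq1 ⊢
        by_contra! hq3
        have hq2 : y q = newX a g j i x q := hq2
        unfold newX at hq2
        rw [mI_eq ha hq3 hq1, hdec, bt_pre hy (show q < dL a m from hq1)] at hq2
        have := hy q
        omega
      have e : (1 / 2 : ℝ) ^ a * ((2 ^ (a * m + a) : ℕ) : ℝ) = ((2 ^ (a * m) : ℕ) : ℝ) := by
        push_cast
        rw [pow_add, mul_comm, mul_assoc, ← mul_pow]
        norm_num
      rw [e]
      exact_mod_cast hle
  linarith

theorem good_eventually {a g : ℕ} (ha : 0 < a) {y x : ℕ → ℕ} (hy : IsBitSeq y)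
    (hxc : Computable x) (hδ : (1 / 2 : ℝ) ^ a < deltaVal y) (J : ℕ) :
    ∀ᶠ m in atTop, ∀ j < J, ¬ bad a g m j (pre x ((j + 1) * rL a g m)) (pre y (dL a m)) := by
  have h : ∀ᶠ m in atTop, ∀ j ∈ Finset.range J, ∀ i ∈ Finset.range (4 ^ g),
      dec a g m j i (pre x ((j + 1) * rL a g m)) ≠ pre y (dL a m) := by
    rw [Filter.eventually_all_finset]
    intro j _
    rw [Filter.eventually_all_finset]
    intro i _
    exact dec_fails ha hy hxc hδ j i
  filter_upwards [h] with m hm j hj hb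
  have hmem : pre y (dL a m) ∈ badList a g m j (pre x ((j + 1) * rL a g m)) := by
    unfold badList
    rw [List.mem_filter]
    exact ⟨List.mem_range.2 (pre_lt hy _), by simpa using hb⟩
  obtain ⟨i, hi, hget⟩ := List.getElem_of_mem hmem
  have hi2 := hi.trans_le (johnson a g m j _)
  refine hm j (Finset.mem_range.2 hj) i (Finset.mem_range.2 hi2) ?_
  unfold dec
  rw [List.getElem?_eq_getElem hi, hget]
  rfl

/-- agreements counted as a sum -/
theorem cz_sum (Y x : ℕ → ℕ) (n : ℕ) :
    cz (agree Y x) n = ∑ t ∈ Finset.range n, if Y t = x t then 1 else 0 := by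
  classical
  rw [cz_eq, Finset.card_filter]
  apply Finset.sum_congr rfl
  intro t _
  exact if_congr Iff.rfl rfl rfl

theorem cz_block {a g : ℕ} (ha : 0 < a) {y x : ℕ → ℕ} (hx : IsBitSeq x) (m j : ℕ)
    (hj1 : 2 ^ g ≤ j) (hj2 : j < 2 ^ g * 4 ^ a) :
    cz (agree (newY a g y) x) ((j + 1) * rL a g m) = cz (agree (newY a g y) x) (j * rL a g m)
      + cnt a g m j (pre x ((j + 1) * rL a g m)) (pre y (dL a m)) := by
  rw [cz_sum, cz_sum, add_mul, one_mul, Finset.sum_range_add]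
  congr 1
  unfold cnt
  apply Finset.sum_congr rfl
  intro u hu
  have hu := Finset.mem_range.1 hu
  have hlt : j * rL a g m + u < (j + 1) * rL a g m := by rw [add_mul, one_mul]; omega
  have hm : mOf a g (j * rL a g m + u) = m := by
    apply mOf_eq ha
    · have := Nat.mul_le_mul_right (rL a g m) hj1
      omega
    · rw [rL_succ, ← mul_assoc]
      exact hlt.trans_le (Nat.mul_le_mul_right _ hj2)
  have hmod : (j * rL a g m + u) % rL a g m = u := by
    rw [mul_comm, Nat.mul_add_mod, Nat.mod_eq_of_lt hu]
  rw [← one_mul (rL a g m), mul_comm 1, mul_one, ← Nat.succ_mul] 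
  rw [bt_pre hx hlt]
  unfold newY
  rw [hm, hmod]

theorem cz_mono (z : Set ℕ) : Monotone (cz z) := by
  classical
  intro m n h
  rw [cz_eq, cz_eq]
  exact Finset.card_le_card (Finset.filter_subset_filter _ (Finset.range_mono h))

theorem newY_delta {a g : ℕ} (ha : 0 < a) (hg : 0 < g) {y : ℕ → ℕ} (hy : IsBitSeq y)
    (hδ : (1 / 2 : ℝ) ^ a < deltaVal y) : 1 / 2 - 2 / 2 ^ g ≤ deltaVal (newY a g y) := by
  apply le_delta
  intro x hx hxc
  have hgood := good_eventually (g := g) ha hy hxc hδ (2 ^ g * 4 ^ a)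
  rw [eventually_atTop] at hgood
  obtain ⟨m0, hm0⟩ := hgood
  set C := cz (agree (newY a g y) x) with hC
  set s := 2 ^ g * rL a g m0 with hs
  set B : ℝ := 2 ^ g with hB
  have hB2 : 2 ≤ B := by
    rw [hB]
    calc (2 : ℝ) = 2 ^ 1 := by norm_num
      _ ≤ 2 ^ g := pow_le_pow_right₀ (by norm_num) hg
  have hstep : ∀ m, m0 ≤ m → ∀ j, 2 ^ g ≤ j → j < 2 ^ g * 4 ^ a →
      (B - 2) * (j * rL a g m - s) ≤ 2 * B * C (j * rL a g m) →
      (B - 2) * ((j + 1 : ℕ) * rL a g m - s) ≤ 2 * B * C ((j + 1) * rL a g m) := by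
    intro m hm j hj1 hj2 ih
    have hb := hm0 m hm j hj2
    unfold bad at hb
    push Not at hb
    have hb' : B * rL a g m ≤ 2 * B * cnt a g m j (pre x ((j + 1) * rL a g m)) (pre y (dL a m))
        + 2 * rL a g m := by
      rw [hB]; exact_mod_cast hb
    rw [hC, cz_block ha hx m j hj1 hj2, ← hC]
    push_cast
    nlinarith
  have hblk : ∀ m, m0 ≤ m →
      (B - 2) * ((2 ^ g * rL a g m : ℕ) - s) ≤ 2 * B * C (2 ^ g * rL a g m) →
      ∀ j, 2 ^ g ≤ j → j ≤ 2 ^ g * 4 ^ a →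
      (B - 2) * (j * rL a g m - s) ≤ 2 * B * C (j * rL a g m) := by
    intro m hm h0 j hj
    induction j, hj using Nat.le_induction with
    | base => intro _; exact_mod_cast h0
    | succ j hj ih =>
      intro hj2
      exact hstep m hm j hj (by omega) (ih (by omega))
  have hmac : ∀ m, m0 ≤ m →
      (B - 2) * ((2 ^ g * rL a g m : ℕ) - s) ≤ 2 * B * C (2 ^ g * rL a g m) := by
    intro m hm
    induction m, hm using Nat.le_induction with
    | base => rw [hs, sub_self, mul_zero]; positivity
    | succ m hm ih =>
      have h1 := hblk m hm ih (2 ^ g * 4 ^ a)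
        (Nat.le_mul_of_pos_right _ (by positivity)) le_rfl
      have e : 2 ^ g * rL a g (m + 1) = 2 ^ g * 4 ^ a * rL a g m := by rw [rL_succ, mul_assoc]
      rw [e]
      exact_mod_cast h1
  apply le_ld
  filter_upwards [eventually_ge_atTop s, eventually_ge_atTop (s * 2 ^ g)] with N hN hN2
  have hex : ∃ m, m0 ≤ m ∧ 2 ^ g * rL a g m ≤ N ∧ N < 2 ^ g * rL a g (m + 1) := by
    have hP : ∃ m, N < 2 ^ g * rL a g m := ⟨N, (le_rL ha g N).trans_le
      (Nat.le_mul_of_pos_left _ (by positivity))⟩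
    classical
    have hsp := Nat.find_spec hP
    have hgt : m0 < Nat.find hP := by
      by_contra! hle
      have := Nat.mul_le_mul_left (2 ^ g) (rL_mono a g hle)
      omega
    obtain ⟨k, hk⟩ : ∃ k, Nat.find hP = k + 1 := ⟨Nat.find hP - 1, by omega⟩
    refine ⟨k, by omega, ?_, ?_⟩
    · have := Nat.find_min hP (m := k) (by omega)
      omega
    · rw [← hk]; exact hsp
  obtain ⟨m, hm, hN3, hN4⟩ := hex
  set r := rL a g m with hr
  have hrp : 0 < r := rL_pos a g m
  have hj1 : 2 ^ g ≤ N / r := (Nat.le_div_iff_mul_le hrp).2 hN3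
  have hj2 : N / r < 2 ^ g * 4 ^ a := by
    rw [Nat.div_lt_iff_lt_mul hrp, mul_assoc, hr, ← rL_succ]; exact hN4
  have h1 := hblk m hm (hmac m hm) (N / r) hj1 hj2.le
  have h2 : C (N / r * r) ≤ C N := cz_mono _ (Nat.div_mul_le_self N r)
  have h3 : N < N / r * r + r := Nat.lt_div_mul_add hrp
  have h2' : (C (N / r * r) : ℝ) ≤ C N := by exact_mod_cast h2
  have h3' : (N : ℝ) ≤ (N / r : ℕ) * r + r := by exact_mod_cast h3.le
  have hN3' : B * r ≤ N := by rw [hB]; exact_mod_cast hN3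
  have hN2' : (s : ℝ) * B ≤ N := by rw [hB]; exact_mod_cast hN2
  have h4 : (B - 2) * (N - r - s) ≤ 2 * B * C N := by
    have t1 : (B - 2) * (N - r - s) ≤ (B - 2) * ((N / r : ℕ) * r - s) :=
      mul_le_mul_of_nonneg_left (by linarith) (by linarith)
    have t2 : 2 * B * (C (N / r * r) : ℝ) ≤ 2 * B * C N :=
      mul_le_mul_of_nonneg_left h2' (by linarith)
    linarith
  have hB0 : 0 < B := by linarith
  have h5 : (B - 2) * (B * N - 2 * N) ≤ 2 * B * B * C N := by
    have t1 : (B - 2) * (B * N - 2 * N) ≤ (B - 2) * (B * (N - r - s)) :=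
      mul_le_mul_of_nonneg_left (by nlinarith) (by linarith)
    have t2 : B * ((B - 2) * (N - r - s)) ≤ B * (2 * B * C N) :=
      mul_le_mul_of_nonneg_left h4 hB0.le
    nlinarith
  have e : (1 / 2 - 2 / B) * N = (B * B - 4 * B) * N / (2 * B * B) := by
    field_simp
    ring
  rw [e, div_le_iff₀ (by positivity)]
  have : (0 : ℝ) ≤ N := by positivity
  nlinarith

/-- For every infinite bit sequence `A`, if `Δ(A) > 0` then `Δ(A) = 1/2`. -/
theorem stmt3 (A : ℕ → ℕ) (hA : IsBitSeq A) (h : 0 < DeltaVal A) :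
    DeltaVal A = 1 / 2 := by
  have hbdd : BddAbove (deltaVal '' {Y | IsBitSeq Y ∧ TuringLE Y A}) :=
    ⟨1 / 2, by rintro _ ⟨Y, _, rfl⟩; exact delta_le_half⟩
  have hne : (deltaVal '' {Y | IsBitSeq Y ∧ TuringLE Y A}).Nonempty :=
    ⟨_, A, ⟨hA, ⟨OracleCode.oracle, fun n => rfl⟩⟩, rfl⟩
  apply le_antisymm
  · apply csSup_le hne
    rintro _ ⟨Y, _, rfl⟩
    exact delta_le_half
  · obtain ⟨_, ⟨y, ⟨hy, hyA⟩, rfl⟩, hpos⟩ := exists_lt_of_lt_csSup hne h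
    obtain ⟨a0, ha0⟩ := exists_pow_lt_of_lt_one hpos (by norm_num : (1 / 2 : ℝ) < 1)
    have ha : (1 / 2 : ℝ) ^ (a0 + 1) < deltaVal y := by
      refine lt_of_le_of_lt ?_ ha0
      exact pow_le_pow_of_le_one (by norm_num) (by norm_num) (Nat.le_succ _)
    apply le_of_forall_pos_le_add
    intro ε hε
    obtain ⟨g, hg⟩ := exists_pow_lt_of_lt_one hε (by norm_num : (1 / 2 : ℝ) < 1)
    have h1 := newY_delta (a := a0 + 1) (g := g + 1) (Nat.succ_pos _) (Nat.succ_pos _) hy ha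
    have h2 : deltaVal (newY (a0 + 1) (g + 1) y) ≤ DeltaVal A :=
      le_csSup hbdd ⟨_, ⟨newY_bit _ _ _, newY_le _ _ hyA⟩, rfl⟩
    have h3 : (2 : ℝ) / 2 ^ (g + 1) = (1 / 2) ^ g := by
      rw [one_div, inv_pow, pow_succ]
      field_simp
    linarith

end Paper
end

section
/- For every real p with 0 < p < 1/2, the cardinal characteristic 𝔡(p) equals 𝔡(≠*, h) for the function h(n) = 2^(2^n). -/
open Filter

namespace Paper

/-! ### List decodable codes -/

/-- Sign of a bit. -/
def sgn (b : Bool) : ℝ := if b then 1 else -1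

lemma sgn_mul_self (b : Bool) : sgn b * sgn b = 1 := by cases b <;> simp [sgn]

/-- Correlation of two bit strings. -/
def corr {l : ℕ} (v w : Fin l → Bool) : ℝ := ∑ i, sgn (v i) * sgn (w i)

lemma corr_comm {l : ℕ} (v w : Fin l → Bool) : corr v w = corr w v := by
  unfold corr; exact Finset.sum_congr rfl fun i _ => mul_comm _ _

lemma corr_self {l : ℕ} (v : Fin l → Bool) : corr v v = l := by
  simp [corr, sgn_mul_self]

lemma sum_exp_corr {l : ℕ} (w : Fin l → Bool) (a : ℝ) :
    ∑ v : Fin l → Bool, Real.exp (a * corr w v) = (2 * Real.cosh a) ^ l := by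
  have h1 : ∀ v : Fin l → Bool, Real.exp (a * corr w v)
      = ∏ i, Real.exp (a * (sgn (w i) * sgn (v i))) := by
    intro v
    rw [← Real.exp_sum, corr, Finset.mul_sum]
  simp_rw [h1]
  have h2 := (Finset.prod_univ_sum (fun _ : Fin l => (Finset.univ : Finset Bool))
    (fun i b => Real.exp (a * (sgn (w i) * sgn b))))
  rw [Fintype.piFinset_univ] at h2
  rw [← h2]
  have h3 : ∀ i : Fin l, ∑ b : Bool, Real.exp (a * (sgn (w i) * sgn b)) = 2 * Real.cosh a := by
    intro i
    rw [Real.cosh_eq]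
    cases w i <;> simp [sgn] <;> ring
  rw [Finset.prod_congr rfl fun i _ => h3 i]
  simp

lemma ball_card {l : ℕ} (w : Fin l → Bool) (t : ℝ) (ht : 0 ≤ t) :
    ((Finset.univ.filter fun v : Fin l → Bool => t * l < corr w v).card : ℝ)
      ≤ 2 ^ l * Real.exp (- (t ^ 2 / 2 * l)) := by
  set A := Finset.univ.filter fun v : Fin l → Bool => t * l < corr w v
  have h1 : (A.card : ℝ) * Real.exp (t * (t * l)) ≤ (2 * Real.cosh t) ^ l := by
    rw [← sum_exp_corr w t, ← nsmul_eq_mul, ← Finset.sum_const]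
    calc ∑ _v ∈ A, Real.exp (t * (t * l)) ≤ ∑ v ∈ A, Real.exp (t * corr w v) := by
          apply Finset.sum_le_sum
          intro v hv
          have := (Finset.mem_filter.1 hv).2
          exact Real.exp_le_exp.2 (mul_le_mul_of_nonneg_left this.le ht)
      _ ≤ _ := Finset.sum_le_sum_of_subset_of_nonneg (Finset.subset_univ _)
          fun _ _ _ => (Real.exp_pos _).le
  have h2 : (2 * Real.cosh t) ^ l ≤ 2 ^ l * Real.exp (t ^ 2 / 2 * l) := by
    rw [mul_pow, mul_comm (t ^ 2 / 2) (l : ℝ), Real.exp_nat_mul]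
    have := Real.cosh_le_exp_half_sq t
    have h0 := (Real.cosh_pos t).le
    gcongr
  have h3 : Real.exp (- (t ^ 2 / 2 * l)) = Real.exp (t ^ 2 / 2 * l) / Real.exp (t * (t * l)) := by
    rw [← Real.exp_sub]; congr 1; ring
  rw [h3, ← mul_div_assoc, le_div_iff₀ (Real.exp_pos _)]
  exact h1.trans h2

/-- Gilbert-Varshamov. -/
lemma exists_code_s4 (l : ℕ) (hl : 0 < l) (t : ℝ) (ht : 0 ≤ t) (ht1 : t < 1) :
    ∃ C : Finset (Fin l → Bool), (∀ v ∈ C, ∀ w ∈ C, v ≠ w → corr v w ≤ t * l) ∧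
      Real.exp (t ^ 2 / 2 * l) ≤ C.card := by
  classical
  have hfin : {C : Finset (Fin l → Bool) |
      ∀ v ∈ C, ∀ w ∈ C, v ≠ w → corr v w ≤ t * l}.Finite := Set.toFinite _
  obtain ⟨C, hC⟩ := hfin.exists_maximal ⟨∅, by simp⟩
  refine ⟨C, hC.prop, ?_⟩
  have hcov : ∀ v : Fin l → Bool, ∃ w ∈ C, t * l < corr w v := by
    intro v
    by_contra! hcon
    have hl' : (0 : ℝ) < l := by exact_mod_cast hl
    have hv : v ∉ C := fun hv => by
      have := hcon v hv
      rw [corr_self] at this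
      nlinarith
    have hle := hC.le_of_ge (y := insert v C) (by
      intro a ha b hb hab
      rw [Finset.mem_insert] at ha hb
      rcases ha with rfl | ha <;> rcases hb with rfl | hb
      · exact absurd rfl hab
      · rw [corr_comm]; exact hcon _ hb
      · exact hcon _ ha
      · exact hC.prop a ha b hb hab) (Finset.subset_insert _ _)
    exact hv (hle (Finset.mem_insert_self _ _))
  have hsub : (Finset.univ : Finset (Fin l → Bool)) ⊆
      C.biUnion fun w => Finset.univ.filter fun v => t * l < corr w v := by
    intro v _
    obtain ⟨w, hw, h⟩ := hcov v
    simp only [Finset.mem_biUnion, Finset.mem_filter, Finset.mem_univ, true_and]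
    exact ⟨w, hw, h⟩
  have h1 := (Finset.card_le_card hsub).trans Finset.card_biUnion_le
  have h2 : (2 : ℝ) ^ l ≤ ∑ w ∈ C, ((Finset.univ.filter fun v => t * l < corr w v).card : ℝ) := by
    simp only [Finset.card_univ, Fintype.card_fun, Fintype.card_bool, Fintype.card_fin] at h1
    exact_mod_cast h1
  have h3 : (2 : ℝ) ^ l ≤ C.card * (2 ^ l * Real.exp (- (t ^ 2 / 2 * l))) := by
    rw [← nsmul_eq_mul, ← Finset.sum_const]
    exact h2.trans (Finset.sum_le_sum fun w _ => ball_card w t ht)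
  rw [Real.exp_neg] at h3
  have h4 := Real.exp_pos (t ^ 2 / 2 * l)
  have h5 : (0 : ℝ) < 2 ^ l := by positivity
  have h6 : (2 : ℝ) ^ l * Real.exp (t ^ 2 / 2 * l) ≤ 2 ^ l * C.card := by
    calc (2 : ℝ) ^ l * Real.exp (t ^ 2 / 2 * l)
        ≤ (C.card * (2 ^ l * (Real.exp (t ^ 2 / 2 * l))⁻¹)) * Real.exp (t ^ 2 / 2 * l) := by gcongr
      _ = _ := by field_simp
  exact le_of_mul_le_mul_left h6 h5

/-- Johnson bound. -/
lemma johnson_s4 {l : ℕ} (hl : 0 < l) (e : ℝ) (he : 0 < e) (σ : Fin l → Bool)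
    (A : Finset (Fin l → Bool))
    (hA : ∀ v ∈ A, ∀ w ∈ A, v ≠ w → corr v w ≤ e ^ 2 / 2 * l)
    (hσ : ∀ v ∈ A, corr σ v < - (e * l)) : (A.card : ℝ) ≤ 2 / e ^ 2 := by
  classical
  set M : ℝ := (A.card : ℝ) with hMdef
  have hl' : (0 : ℝ) < l := by exact_mod_cast hl
  have hM : 0 ≤ M := Nat.cast_nonneg _
  have h1 : ∑ i, (∑ v ∈ A, sgn (v i)) ^ 2 ≤ M * l + M ^ 2 * (e ^ 2 / 2 * l) := by
    have : ∑ i, (∑ v ∈ A, sgn (v i)) ^ 2 = ∑ v ∈ A, ∑ w ∈ A, corr v w := by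
      simp_rw [sq, Finset.sum_mul_sum, corr]
      rw [Finset.sum_comm]
      refine Finset.sum_congr rfl fun v _ => ?_
      rw [Finset.sum_comm]
    rw [this]
    calc ∑ v ∈ A, ∑ w ∈ A, corr v w
        ≤ ∑ v ∈ A, ∑ w ∈ A, ((if v = w then (l : ℝ) else 0) + e ^ 2 / 2 * l) := by
          refine Finset.sum_le_sum fun v hv => Finset.sum_le_sum fun w hw => ?_
          split_ifs with h
          · subst h; rw [corr_self]; have : 0 ≤ e ^ 2 / 2 * l := by positivity
            linarith
          · simpa using hA v hv w hw h
      _ = M * l + M ^ 2 * (e ^ 2 / 2 * l) := by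
          simp only [Finset.sum_add_distrib, Finset.sum_ite_eq, Finset.sum_const, nsmul_eq_mul]
          rw [Finset.sum_congr rfl (fun v hv => if_pos hv)]
          simp only [Finset.sum_const, nsmul_eq_mul]
          ring
  have h2 : ∑ v ∈ A, corr σ v = ∑ i, sgn (σ i) * ∑ v ∈ A, sgn (v i) := by
    simp_rw [corr, Finset.mul_sum]
    rw [Finset.sum_comm]
  have h3 : ∑ v ∈ A, corr σ v ≤ - (M * (e * l)) := by
    calc ∑ v ∈ A, corr σ v ≤ ∑ v ∈ A, - (e * l) := Finset.sum_le_sum fun v hv => (hσ v hv).le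
      _ = _ := by simp only [Finset.sum_const, nsmul_eq_mul]; ring
  have h4 := Finset.sum_mul_sq_le_sq_mul_sq Finset.univ (fun i => sgn (σ i))
    (fun i => ∑ v ∈ A, sgn (v i))
  rw [← h2] at h4
  have h5 : ∑ i, sgn (σ i) ^ 2 = (l : ℝ) := by simp [sq, sgn_mul_self]
  rw [h5] at h4
  have h6 : (M * (e * l)) ^ 2 ≤ (∑ v ∈ A, corr σ v) ^ 2 := by
    have : 0 ≤ M * (e * l) := by positivity
    nlinarith
  have h7 : (M * (e * l)) ^ 2 ≤ l * (M * l + M ^ 2 * (e ^ 2 / 2 * l)) :=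
    h6.trans (h4.trans (mul_le_mul_of_nonneg_left h1 hl'.le))
  rw [le_div_iff₀ (by positivity)]
  rcases hM.eq_or_lt with h0 | h0
  · rw [← h0]; norm_num
  · have : (M * l ^ 2) * (M * e ^ 2) ≤ (M * l ^ 2) * 2 := by nlinarith
    exact le_of_mul_le_mul_left this (by positivity)

lemma list_decoding (e : ℝ) (he : 0 < e) (he1 : e ≤ 1) :
    ∃ L c : ℕ, 0 < L ∧ 0 < c ∧ ∀ m : ℕ, 0 < m →
      ∃ E : (Fin L → Fin (2 ^ m)) → (Fin (c * m) → Bool), ∀ σ : Fin (c * m) → Bool,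
        (Finset.univ.filter fun τ => corr σ (E τ) < - (e * (c * m : ℕ))).card ≤ L := by
  classical
  obtain ⟨L, hL⟩ := exists_nat_ge (2 / e ^ 2)
  have hLpos : (0 : ℝ) < L := lt_of_lt_of_le (by positivity) hL
  set t := e ^ 2 / 2 with ht
  have ht0 : 0 < t := by positivity
  obtain ⟨c, hc⟩ := exists_nat_ge (L / (t ^ 2 / 2))
  have hcpos : (0 : ℝ) < c := lt_of_lt_of_le (by positivity) hc
  rw [div_le_iff₀ (by positivity)] at hc
  refine ⟨L, c, by exact_mod_cast hLpos, by exact_mod_cast hcpos, fun m hm => ?_⟩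
  have hl : 0 < c * m := Nat.mul_pos (by exact_mod_cast hcpos) hm
  obtain ⟨C, hC, hcard⟩ := exists_code_s4 (c * m) hl t ht0.le (by nlinarith)
  have h1 : (2 : ℝ) ^ (m * L) ≤ Real.exp (t ^ 2 / 2 * (c * m : ℕ)) := by
    have h2 : (2 : ℝ) ≤ Real.exp 1 := by have := Real.add_one_le_exp (1 : ℝ); linarith
    calc (2 : ℝ) ^ (m * L) ≤ Real.exp 1 ^ (m * L) := by gcongr
      _ = Real.exp ((m * L : ℕ)) := by rw [← Real.exp_nat_mul]; simp
      _ ≤ _ := by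
        apply Real.exp_le_exp.2
        push_cast
        have : (0 : ℝ) ≤ m := Nat.cast_nonneg _
        nlinarith
  have h2 : Fintype.card (Fin L → Fin (2 ^ m)) ≤ Fintype.card C := by
    have : (2 : ℝ) ^ (m * L) ≤ C.card := h1.trans hcard
    simp only [Fintype.card_fun, Fintype.card_fin, Fintype.card_coe, ← pow_mul]
    exact_mod_cast this
  obtain ⟨f⟩ := Function.Embedding.nonempty_of_card_le h2
  refine ⟨fun τ => (f τ).1, fun σ => ?_⟩
  set B := Finset.univ.filter fun τ => corr σ (f τ).1 < - (e * (c * m : ℕ))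
  have hinj : Function.Injective fun τ => (f τ).1 := Subtype.val_injective.comp f.injective
  have h3 := johnson_s4 hl e he σ (B.image fun τ => (f τ).1) (by
    intro v hv w hw
    obtain ⟨a, -, rfl⟩ := Finset.mem_image.1 hv
    obtain ⟨b, -, rfl⟩ := Finset.mem_image.1 hw
    exact hC _ (f a).2 _ (f b).2) (by
    intro v hv
    obtain ⟨a, ha, rfl⟩ := Finset.mem_image.1 hv
    exact (Finset.mem_filter.1 ha).2)
  rw [Finset.card_image_of_injective _ hinj] at h3
  exact_mod_cast h3.trans hL

/-- Slalom trick: a set of at most `L` tuples of length `L` is hit by a diagonal tuple. -/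
lemma diag_tuple {L N : ℕ} (A : Finset (Fin L → Fin N)) (hA : A.card ≤ L) :
    ∃ z : Fin L → ℕ, ∀ τ ∈ A, ∃ j, z j = (τ j : ℕ) := by
  classical
  have h : Fintype.card A ≤ Fintype.card (Fin L) := by simpa using hA
  obtain ⟨f⟩ := Function.Embedding.nonempty_of_card_le h
  refine ⟨fun j => if h : ∃ a : A, f a = j then ((h.choose.1 j : Fin N) : ℕ) else 0, ?_⟩
  intro τ hτ
  refine ⟨f ⟨τ, hτ⟩, ?_⟩
  have h : ∃ a : A, f a = f ⟨τ, hτ⟩ := ⟨_, rfl⟩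
  have h2 : h.choose = ⟨τ, hτ⟩ := f.injective h.choose_spec
  simp only [dif_pos h]
  rw [h2]

/-! ### Densities and blocks -/

/-- Number of agreements below `N`. -/
def agr (x y : ℕ → ℕ) (N : ℕ) : ℕ := ∑ n ∈ Finset.range N, if x n = y n then 1 else 0

lemma card_agree (x y : ℕ → ℕ) (N : ℕ) :
    Nat.card ↥(agree x y ∩ Set.Iio N) = agr x y N := by
  unfold agr
  rw [← Finset.card_filter, Nat.card_coe_set_eq, ← Set.ncard_coe_finset]
  congr 1
  ext n
  simp [agree, and_comm]

lemma agr_le (x y : ℕ → ℕ) (N : ℕ) : agr x y N ≤ N := by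
  unfold agr
  rw [← Finset.card_filter]
  exact (Finset.card_filter_le _ _).trans (by simp)

lemma agr_mono (x y : ℕ → ℕ) : Monotone (agr x y) := by
  intro a b hab
  exact Finset.sum_le_sum_of_subset (Finset.range_mono hab)

lemma lowerDensity_eq (x y : ℕ → ℕ) : lowerDensity (agree x y)
    = Filter.liminf (fun n => (agr x y n : ℝ) / n) Filter.atTop := by
  unfold lowerDensity
  simp_rw [card_agree]

lemma eventually_of_lt {x y : ℕ → ℕ} {p : ℝ} (h : p < lowerDensity (agree x y)) :
    ∀ᶠ N in atTop, p < (agr x y N : ℝ) / N := by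
  rw [lowerDensity_eq] at h
  refine eventually_lt_of_lt_liminf h ?_
  exact isBoundedUnder_of ⟨0, fun n => by positivity⟩

lemma le_lowerDensity {x y : ℕ → ℕ} {p : ℝ} (h : ∀ᶠ N in atTop, p ≤ (agr x y N : ℝ) / N) :
    p ≤ lowerDensity (agree x y) := by
  rw [lowerDensity_eq]
  refine le_liminf_of_le ?_ h
  refine IsBoundedUnder.isCoboundedUnder_ge (isBoundedUnder_of ⟨1, fun n => ?_⟩)
  exact div_le_one_of_le₀ (by exact_mod_cast agr_le x y n) (Nat.cast_nonneg _)

/-- Starting points of consecutive blocks of lengths `l`. -/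
def st (l : ℕ → ℕ) (t : ℕ) : ℕ := ∑ j ∈ Finset.range t, l j

lemma st_succ (l : ℕ → ℕ) (t : ℕ) : st l (t + 1) = st l t + l t := Finset.sum_range_succ _ _

lemma st_strictMono {l : ℕ → ℕ} (hl : ∀ t, 0 < l t) : StrictMono (st l) :=
  strictMono_nat_of_lt_succ fun t => by rw [st_succ]; have := hl t; omega

lemma exists_block {l : ℕ → ℕ} (hl : ∀ t, 0 < l t) (N : ℕ) :
    ∃ t, st l t ≤ N ∧ N < st l (t + 1) := by
  induction N with
  | zero => exact ⟨0, by simp [st], by rw [st_succ]; have := hl 0; omega⟩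
  | succ N ih =>
    obtain ⟨t, h1, h2⟩ := ih
    by_cases h : N + 1 < st l (t + 1)
    · exact ⟨t, by omega, h⟩
    · refine ⟨t + 1, by omega, ?_⟩
      rw [st_succ l (t + 1)]; have := hl (t + 1); omega

lemma exists_glue {l : ℕ → ℕ} (hl : ∀ t, 0 < l t) (B : ℕ → ℕ → ℕ) (hB : ∀ t o, B t o < 2) :
    ∃ X : ℕ → ℕ, IsBitSeq X ∧ ∀ t o, o < l t → X (st l t + o) = B t o := by
  choose idx h1 h2 using exists_block hl
  refine ⟨fun N => B (idx N) (N - st l (idx N)), fun N => hB _ _, fun t o ho => ?_⟩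
  have hidx : idx (st l t + o) = t := by
    have a1 : st l t < st l (idx (st l t + o) + 1) := lt_of_le_of_lt (by omega) (h2 (st l t + o))
    have a2 : st l (idx (st l t + o)) < st l (t + 1) :=
      lt_of_le_of_lt (h1 (st l t + o)) (by rw [st_succ]; omega)
    have b1 := (st_strictMono hl).lt_iff_lt.1 a1
    have b2 := (st_strictMono hl).lt_iff_lt.1 a2
    omega
  simp only [hidx]
  congr 1
  omega

lemma agr_add (x y : ℕ → ℕ) (a b : ℕ) : agr x y (a + b)
    = agr x y a + agr (fun o => x (a + o)) (fun o => y (a + o)) b := by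
  unfold agr
  rw [Finset.sum_range_add]

lemma density_of_blocks {l : ℕ → ℕ} (hl : ∀ t, 0 < l t) (k D t0 : ℕ) (hk : 0 < k)
    (hkl : ∀ t, k * l t ≤ st l t + D) (q r : ℝ) (hq : 0 ≤ q) (hr : r * (k + 1) < q * k)
    (x y : ℕ → ℕ)
    (h : ∀ t, t0 ≤ t → q * l t ≤ agr (fun o => x (st l t + o)) (fun o => y (st l t + o)) (l t)) :
    r ≤ lowerDensity (agree x y) := by
  apply le_lowerDensity
  have h1 : ∀ t, t0 ≤ t → q * (st l t - st l t0) ≤ agr x y (st l t) := by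
    intro t ht
    induction t, ht using Nat.le_induction with
    | base => simp
    | succ t ht ih =>
      rw [st_succ, agr_add]
      push_cast
      have := h t ht
      nlinarith
  obtain ⟨N0, hN0⟩ := exists_nat_ge ((q * (D + (k + 1) * st l t0)) / (q * k - r * (k + 1)))
  rw [div_le_iff₀ (by linarith)] at hN0
  filter_upwards [eventually_ge_atTop (max N0 (st l t0)), eventually_gt_atTop 0] with N hN hNpos
  have hN1 : N0 ≤ N := (le_max_left _ _).trans hN
  have hN2 : st l t0 ≤ N := (le_max_right _ _).trans hN
  obtain ⟨t, ht1, ht2⟩ := exists_block hl N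
  have ht : t0 ≤ t := by
    have := (st_strictMono hl).lt_iff_lt.1 (lt_of_le_of_lt hN2 ht2)
    omega
  have hNpos' : (0 : ℝ) < N := by exact_mod_cast hNpos
  rw [le_div_iff₀ hNpos']
  have h2 := h1 t ht
  have h3 : (agr x y (st l t) : ℝ) ≤ agr x y N := by exact_mod_cast agr_mono x y ht1
  rw [st_succ] at ht2
  have h4 : k * N ≤ (k + 1) * st l t + D := by
    have := hkl t
    have : k * N ≤ k * (st l t + l t) := Nat.mul_le_mul_left k ht2.le
    nlinarith
  have h4' : (k : ℝ) * N ≤ (k + 1) * st l t + D := by exact_mod_cast h4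
  have h5 : (N0 : ℝ) * (q * k - r * (k + 1)) ≤ N * (q * k - r * (k + 1)) := by
    have : (N0 : ℝ) ≤ N := by exact_mod_cast hN1
    exact mul_le_mul_of_nonneg_right this (by linarith)
  have h6 : q * (k * N) ≤ q * ((k + 1) * st l t + D) := mul_le_mul_of_nonneg_left h4' hq
  have hk1 : (0 : ℝ) < k + 1 := by positivity
  have h7 : (k + 1) * (r * N) ≤ (k + 1) * (agr x y N : ℝ) := by
    have : (k + 1 : ℝ) * (q * (st l t - st l t0)) ≤ (k + 1) * agr x y N :=
      mul_le_mul_of_nonneg_left (h2.trans h3) hk1.le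
    nlinarith
  exact le_of_mul_le_mul_left h7 hk1

/-! ### Eventually different families -/

/-- `G` is a witness for `dNeq h`. -/
def Fam (h : ℕ → ℕ) (G : Set (ℕ → ℕ)) : Prop :=
  (∀ y ∈ G, ∀ n, y n < h n) ∧ ∀ x : ℕ → ℕ, ∃ y ∈ G, ∀ᶠ n in atTop, x n ≠ y n

lemma Fam.infinite {h : ℕ → ℕ} {G : Set (ℕ → ℕ)} (hG : Fam h G) : G.Infinite := by
  intro hfin
  obtain ⟨y0, hy0, -⟩ := hG.2 0
  obtain ⟨f, hf⟩ := hfin.countable.exists_eq_range ⟨y0, hy0⟩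
  obtain ⟨y, hy, hne⟩ := hG.2 fun n => f n.unpair.1 n
  rw [hf] at hy
  obtain ⟨i, rfl⟩ := hy
  obtain ⟨N, hN⟩ := eventually_atTop.1 hne
  have := hN (Nat.pair i N) (Nat.right_le_pair i N)
  simp at this

lemma mk_tuples {G : Set (ℕ → ℕ)} (hG : G.Infinite) (ι : Type) [Fintype ι] :
    Cardinal.mk (ι → G) ≤ Cardinal.mk G := by
  have h1 : Cardinal.aleph0 ≤ Cardinal.mk G := by
    rw [Cardinal.aleph0_le_mk_iff]; exact hG.to_subtype
  rw [← Cardinal.power_def, Cardinal.mk_fintype ι]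
  exact Cardinal.power_nat_le h1

/-- Direction 2. -/
lemma fam_of_density (p : ℝ) (hp0 : 0 < p) (G : Set (ℕ → ℕ)) (hbit : ∀ y ∈ G, IsBitSeq y)
    (hG : ∀ x : ℕ → ℕ, IsBitSeq x → ∃ y ∈ G, p < lowerDensity (agree x y)) :
    ∃ G' : Set (ℕ → ℕ), Fam (fun n => 2 ^ 2 ^ n) G' ∧ Cardinal.mk G' ≤ Cardinal.mk G := by
  classical
  obtain ⟨k, hk⟩ : ∃ k : ℕ, (1 / 2 : ℝ) ^ k < p := exists_pow_lt_of_lt_one hp0 (by norm_num)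
  have hk2 : (1 / 2 : ℝ) ^ (k + 1) < p :=
    lt_of_le_of_lt (pow_le_pow_of_le_one (by norm_num) (by norm_num) (Nat.le_succ k)) hk
  generalize hK : k + 1 = K at hk2
  have hKpos : 0 < K := by omega
  set l : ℕ → ℕ := fun n => 2 ^ (K * n) with hl
  have hlpos : ∀ t, 0 < l t := fun t => by positivity
  have hst : ∀ n, st l n * 2 ^ K + 1 ≤ st l (n + 1) := by
    intro n
    induction n with
    | zero => simp [st, hl]
    | succ n ih =>
      rw [st_succ l (n + 1), st_succ l n, add_mul]
      rw [st_succ] at ih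
      have : l (n + 1) = l n * 2 ^ K := by simp only [hl]; rw [← pow_add]; ring_nf
      rw [this]
      omega
  let code : (ℕ → ℕ) → ℕ → ℕ := fun y n =>
    (finFunctionFinEquiv (fun i : Fin (l n) => (⟨y (st l n + i) % 2, Nat.mod_lt _ two_pos⟩ : Fin 2)) :
      Fin (2 ^ l n))
  have hcode : ∀ y n, code y n < 2 ^ l n := fun y n => Fin.is_lt _
  have hfam1 : Fam (fun n => 2 ^ l n) (Set.image code G) := by
    refine ⟨?_, ?_⟩
    · rintro _ ⟨y, -, rfl⟩ n
      exact hcode y n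
    · intro x
      obtain ⟨X, hX, hXB⟩ := exists_glue hlpos (fun n o =>
        if h : x n < 2 ^ l n ∧ o < l n then
          1 - ((finFunctionFinEquiv.symm (⟨x n, h.1⟩ : Fin (2 ^ l n)) ⟨o, h.2⟩ : Fin 2) : ℕ)
        else 0) (by intro t o; split_ifs <;> omega)
      obtain ⟨y, hy, hpy⟩ := hG X hX
      refine ⟨code y, ⟨y, hy, rfl⟩, ?_⟩
      have hev := (eventually_of_lt hpy)
      have htend : Tendsto (fun n => st l (n + 1)) atTop atTop :=
        (st_strictMono hlpos).tendsto_atTop.comp (tendsto_add_atTop_nat 1)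
      filter_upwards [htend.eventually hev] with n hn heq
      have hdis : agr (fun o => X (st l n + o)) (fun o => y (st l n + o)) (l n) = 0 := by
        unfold agr
        refine Finset.sum_eq_zero fun o ho => if_neg ?_
        have ho : o < l n := Finset.mem_range.1 ho
        have hx : x n < 2 ^ l n := by rw [heq]; exact hcode y n
        show ¬ X (st l n + o) = y (st l n + o)
        rw [hXB n o ho, dif_pos ⟨hx, ho⟩]
        have : (⟨x n, hx⟩ : Fin (2 ^ l n)) = finFunctionFinEquiv (fun i : Fin (l n) =>
            (⟨y (st l n + i) % 2, Nat.mod_lt _ two_pos⟩ : Fin 2)) := Fin.ext heq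
        rw [this, Equiv.symm_apply_apply]
        have := hbit y hy (st l n + o)
        dsimp only
        omega
      rw [st_succ, agr_add, hdis, ← st_succ, add_zero] at hn
      have hpos : (0 : ℝ) < st l (n + 1) := by
        have := hst n
        exact_mod_cast (by omega : 0 < st l (n + 1))
      rw [lt_div_iff₀ hpos] at hn
      have h1 : (agr X y (st l n) : ℝ) ≤ st l n := by exact_mod_cast agr_le _ _ _
      have h2 : (st l n : ℝ) * 2 ^ K + 1 ≤ st l (n + 1) := by exact_mod_cast hst n
      have h3 : (1 / 2 : ℝ) ^ K * st l (n + 1) < p * st l (n + 1) :=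
        mul_lt_mul_of_pos_right hk2 hpos
      have h4 : (1 / 2 : ℝ) ^ K * (st l n * 2 ^ K + 1) ≤ (1 / 2 : ℝ) ^ K * st l (n + 1) :=
        mul_le_mul_of_nonneg_left h2 (by positivity)
      have h5 : (1 / 2 : ℝ) ^ K * (st l n * 2 ^ K + 1) = st l n + (1 / 2 : ℝ) ^ K := by
        rw [one_div, inv_pow]; field_simp
      have h6 : (0 : ℝ) < (1 / 2) ^ K := by positivity
      linarith
  let mix : (Fin K → (Set.image code G)) → ℕ → ℕ := fun F m =>
    (F ⟨m % K, Nat.mod_lt _ hKpos⟩).1 (m / K)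
  refine ⟨Set.range mix, ⟨?_, ?_⟩, ?_⟩
  · rintro _ ⟨F, rfl⟩ m
    refine (hfam1.1 _ (F ⟨m % K, Nat.mod_lt _ hKpos⟩).2 (m / K)).trans_le ?_
    exact Nat.pow_le_pow_right two_pos (Nat.pow_le_pow_right two_pos (Nat.mul_div_le m K))
  · intro x
    choose F hF hne using fun i : Fin K => hfam1.2 (fun n => x (K * n + i))
    let F' : Fin K → (Set.image code G) := fun i => ⟨F i, hF i⟩
    refine ⟨mix F', ⟨F', rfl⟩, ?_⟩
    have hall := eventually_all.2 hne
    have htend : Tendsto (fun m => m / K) atTop atTop := Nat.tendsto_div_const_atTop hKpos.ne'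
    filter_upwards [htend.eventually hall] with m hm
    have := hm ⟨m % K, Nat.mod_lt _ hKpos⟩
    simpa only [Nat.div_add_mod] using this
  · exact Cardinal.mk_range_le.trans ((mk_tuples hfam1.infinite _).trans Cardinal.mk_image_le)

lemma st_exp (c k : ℕ) (hk : 0 < k) (t : ℕ) :
    st (fun t => c * 2 ^ (t / k)) t + c * k = c * 2 ^ (t / k) * (k + t % k) := by
  induction t with
  | zero => simp [st]
  | succ t ih =>
    rw [st_succ]
    have hlt := Nat.mod_lt t hk
    by_cases h : t % k + 1 = k
    · have hd : k ∣ t + 1 := by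
        refine ⟨t / k + 1, ?_⟩
        have := Nat.div_add_mod t k
        rw [mul_add]; omega
      have h1 : (t + 1) / k = t / k + 1 := Nat.succ_div_of_dvd hd
      have h2 : (t + 1) % k = 0 := Nat.mod_eq_zero_of_dvd hd
      rw [h1, h2, pow_succ, add_right_comm, ih]
      obtain ⟨r, hr⟩ : ∃ r, r = t % k := ⟨_, rfl⟩
      rw [← hr] at h ⊢
      rw [← h]; ring
    · have hmod : (t + 1) % k = t % k + 1 := by
        rw [Nat.add_mod, Nat.mod_eq_of_lt (a := 1) (by omega), Nat.mod_eq_of_lt (by omega)]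
      have h1 : (t + 1) / k = t / k := Nat.succ_div_of_not_dvd fun hd => by
        have := Nat.mod_eq_zero_of_dvd hd; omega
      rw [h1, hmod, add_right_comm, ih]
      ring

/-- Direction 1. -/
lemma density_of_fam (p : ℝ) (hp0 : 0 < p) (hp1 : p < 1 / 2) (G : Set (ℕ → ℕ))
    (hG : Fam (fun n => 2 ^ 2 ^ n) G) :
    ∃ G' : Set (ℕ → ℕ), (∀ y ∈ G', IsBitSeq y) ∧
      (∀ x : ℕ → ℕ, IsBitSeq x → ∃ y ∈ G', p < lowerDensity (agree x y)) ∧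
      Cardinal.mk G' ≤ Cardinal.mk G := by
  classical
  obtain ⟨r, hr1, hr2⟩ := exists_between hp1
  obtain ⟨q, hq1, hq2⟩ := exists_between hr2
  obtain ⟨L, c, hL, hc, hE⟩ := list_decoding (1 - 2 * q) (by linarith) (by linarith)
  obtain ⟨k0, hk0⟩ := exists_nat_gt (r / (q - r))
  obtain ⟨k, hk⟩ : ∃ k, k = k0 + 1 := ⟨_, rfl⟩
  have hkpos : 0 < k := by omega
  have hkr : r * (k + 1) < q * k := by
    rw [div_lt_iff₀ (by linarith)] at hk0
    rw [hk]; push_cast; nlinarith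
  choose E hE using fun n : ℕ => hE (2 ^ n) (by positivity)
  set l : ℕ → ℕ := fun t => c * 2 ^ (t / k) with hl
  have hlpos : ∀ t, 0 < l t := fun t => by positivity
  let B : (Fin k × Fin L → G) → ℕ → ℕ → ℕ := fun F t o =>
    if h : o < l t then
      if E (t / k) (fun j => ⟨(F (⟨t % k, Nat.mod_lt _ hkpos⟩, j)).1 (t / k), hG.1 _ (F _).2 _⟩) ⟨o, h⟩
        then 1 else 0
    else 0
  have hB : ∀ F t o, B F t o < 2 := by
    intro F t o; dsimp only [B]; split_ifs <;> norm_num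
  choose Y hYbit hY using fun F => exists_glue hlpos (B F) (hB F)
  refine ⟨Set.range Y, ?_, ?_, Cardinal.mk_range_le.trans (mk_tuples hG.infinite _)⟩
  · rintro _ ⟨F, rfl⟩; exact hYbit F
  intro X hX
  let σ : ∀ t, Fin (l t) → Bool := fun t o => decide (X (st l t + o) = 1)
  choose z hz using fun t => diag_tuple _ (hE (t / k) (σ t))
  choose F hF hne using fun ij : Fin k × Fin L => hG.2 (fun n => z (k * n + ij.1) ij.2)
  let F' : Fin k × Fin L → G := fun ij => ⟨F ij, hF ij⟩
  refine ⟨Y F', ⟨_, rfl⟩, hr1.trans_le ?_⟩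
  have hall := eventually_all.2 hne
  have htend : Tendsto (fun m => m / k) atTop atTop := Nat.tendsto_div_const_atTop hkpos.ne'
  obtain ⟨t0, ht0⟩ := eventually_atTop.1 (htend.eventually hall)
  refine density_of_blocks hlpos k (c * k) t0 hkpos ?_ q r (by linarith) hkr X (Y F') ?_
  · intro t
    rw [hl, st_exp c k hkpos t]
    nlinarith [Nat.zero_le (c * 2 ^ (t / k) * (t % k))]
  intro t ht
  set τ : Fin L → Fin (2 ^ 2 ^ (t / k)) := fun j =>
    ⟨(F' (⟨t % k, Nat.mod_lt _ hkpos⟩, j)).1 (t / k), hG.1 _ (F' _).2 _⟩ with hτ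
  have hfar : - ((1 - 2 * q) * (l t : ℕ)) ≤ corr (σ t) (E (t / k) τ) := by
    by_contra! hcon
    obtain ⟨j, hj⟩ := hz t τ (Finset.mem_filter.2 ⟨Finset.mem_univ _, hcon⟩)
    have h1 := ht0 t ht (⟨t % k, Nat.mod_lt _ hkpos⟩, j)
    simp only [Nat.div_add_mod] at h1
    exact h1 hj
  have hcorr : corr (σ t) (E (t / k) τ)
      = 2 * (agr (fun o => X (st l t + o)) (fun o => Y F' (st l t + o)) (l t) : ℝ) - l t := by
    have h1 : ∀ o : Fin (l t), sgn (σ t o) * sgn (E (t / k) τ o)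
        = 2 * (if X (st l t + o) = Y F' (st l t + o) then 1 else 0) - 1 := by
      intro o
      rw [hY F' t o o.2]
      have hb : B F' t o = if E (t / k) τ o then 1 else 0 := by
        dsimp only [B]; rw [dif_pos o.2]
      rw [hb]
      have hx := hX (st l t + o)
      have hσ : σ t o = decide (X (st l t + o) = 1) := rfl
      rw [hσ]
      have hx' : X (st l t + o) = 0 ∨ X (st l t + o) = 1 := by omega
      rcases hx' with h | h <;> cases E (t / k) τ o <;> simp [h, sgn] <;> norm_num
    unfold agr
    rw [Finset.sum_range]
    push_cast
    rw [Finset.mul_sum]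
    have h2 : (l t : ℝ) = ∑ _o : Fin (l t), (1 : ℝ) := by simp
    rw [h2, ← Finset.sum_sub_distrib]
    exact Finset.sum_congr rfl fun o _ => h1 o
  rw [hcorr] at hfar
  linarith

lemma dNeq_set_nonempty : Fam (fun n => 2 ^ 2 ^ n) {y | ∀ n, y n < 2 ^ 2 ^ n} := by
  refine ⟨fun y hy => hy, fun x => ⟨fun n => if x n = 0 then 1 else 0, ?_, ?_⟩⟩
  · intro n
    have : 1 < 2 ^ 2 ^ n := Nat.one_lt_two_pow (by positivity)
    dsimp only
    split_ifs <;> omega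
  · exact Eventually.of_forall fun n => by dsimp only; split_ifs <;> omega

/-- For every real `p` with `0 < p < 1/2`, `𝔡(p) = 𝔡(≠*, n ↦ 2^(2^n))`. -/
theorem stmt4 (p : ℝ) (hp0 : 0 < p) (hp1 : p < 1 / 2) :
    dChar p = dNeq fun n => 2 ^ 2 ^ n := by
  apply le_antisymm
  · refine le_csInf ⟨_, _, rfl, dNeq_set_nonempty.1, dNeq_set_nonempty.2⟩ ?_
    rintro _ ⟨G, rfl, h1, h2⟩
    obtain ⟨G', a, b, d⟩ := density_of_fam p hp0 hp1 G ⟨h1, h2⟩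
    refine le_trans (csInf_le' ?_) d
    exact ⟨G', rfl, a, b⟩
  · obtain ⟨G', a, b, -⟩ := density_of_fam p hp0 hp1 _ dNeq_set_nonempty
    refine le_csInf ⟨_, G', rfl, a, b⟩ ?_
    rintro _ ⟨G, rfl, h1, h2⟩
    obtain ⟨G'', c, d⟩ := fam_of_density p hp0 G h1 h2
    refine le_trans (csInf_le' ?_) d
    exact ⟨G'', rfl, c.1, c.2⟩

end Paper
end
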